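/- arXiv:1803.01040 — 2 statements merged into one kernel-verified Lean document; each statement's English description precedes it below -/
import Mathlib

section
/- Let A w = Σ_{|α|=k} A_α ∂^α w and B u = Σ_{|β|=l} B_β ∂^β u be homogeneous constant-coefficient linear differential operators on ℝ^n (A_α ∈ Lin(W,X), B_β ∈ Lin(V,W)), both of whose symbols A(ξ) = Σ_{|α|=k} ξ^α A_α and B(ξ) = Σ_{|β|=l} ξ^β B_β have constant rank on ℝ^n \ {0}, and such that ker A(ξ) = im B(ξ) for all ξ ∈ ℝ^n \ {0}. Then for every smooth ℤ^n-periodic function w : ℝ^n → W with A w = 0 and ∫_{[0,1]^n} w(x) dx = 0, there exists a smooth ℤ^n-periodic function u : ℝ^n → V such that w = B u. -/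
open MeasureTheory
open scoped BigOperators

/-- First-order partial derivative in the `i`-th coordinate direction. -/
noncomputable def pderivI {n : ℕ} {W : Type*} [NormedAddCommGroup W] [NormedSpace ℝ W]
    (i : Fin n) (f : (Fin n → ℝ) → W) : (Fin n → ℝ) → W :=
  fun x => fderiv ℝ f x (Pi.single i 1)

/-- The iterated partial derivative `∂^α` associated to a multi-index `α : Fin n → ℕ`. -/
noncomputable def partialDerivMulti {n : ℕ} {W : Type*} [NormedAddCommGroup W]
    [NormedSpace ℝ W] (α : Fin n → ℕ) (f : (Fin n → ℝ) → W) : (Fin n → ℝ) → W :=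
  (List.finRange n).foldr (fun i g => (pderivI i)^[α i] g) f

/-- The homogeneous constant-coefficient differential operator
`A w = ∑_{|α| = k} A_α ∂^α w`. -/
noncomputable def diffOp {n : ℕ} {W X : Type*} [NormedAddCommGroup W] [NormedSpace ℝ W]
    [NormedAddCommGroup X] [NormedSpace ℝ X]
    (k : ℕ) (coef : (Fin n → ℕ) → (W →ₗ[ℝ] X)) (f : (Fin n → ℝ) → W) : (Fin n → ℝ) → X :=
  fun x => ∑ α ∈ Finset.Nat.antidiagonalTuple n k, coef α (partialDerivMulti α f x)

/-- The symbol `A(ξ) = ∑_{|α| = k} ξ^α A_α` of the operator `diffOp k coef`. -/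
noncomputable def symbolOf {n : ℕ} {W X : Type*} [NormedAddCommGroup W] [NormedSpace ℝ W]
    [NormedAddCommGroup X] [NormedSpace ℝ X]
    (k : ℕ) (coef : (Fin n → ℕ) → (W →ₗ[ℝ] X)) (ξ : Fin n → ℝ) : W →ₗ[ℝ] X :=
  ∑ α ∈ Finset.Nat.antidiagonalTuple n k, (∏ i, ξ i ^ α i) • coef α

/-- The phase `x ↦ 2π z · x` of the Fourier mode `z`. -/
noncomputable def phase {n : ℕ} (z : Fin n → ℤ) : (Fin n → ℝ) →L[ℝ] ℝ :=
  ∑ i, (2 * Real.pi * z i) • ContinuousLinearMap.proj i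

/-- The real Fourier coefficient `∫_{[0,1]^n} cos (2π z · y - θ) f y dy`. -/
noncomputable def cubeCoef {n : ℕ} {W : Type*} [NormedAddCommGroup W] [NormedSpace ℝ W]
    (f : (Fin n → ℝ) → W) (z : Fin n → ℤ) (θ : ℝ) : W :=
  ∫ y in Set.Icc (0 : Fin n → ℝ) 1, Real.cos (phase z y - θ) • f y

/-- Smooth `ℤ^n`-periodic functions. -/
def SmoothPeriodic {n : ℕ} {W : Type*} [NormedAddCommGroup W] [NormedSpace ℝ W]
    (f : (Fin n → ℝ) → W) : Prop :=
  ContDiff ℝ (⊤ : ℕ∞) f ∧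
    ∀ (x : Fin n → ℝ) (z : Fin n → ℤ), f (x + fun i => (z i : ℝ)) = f x

theorem phase_apply {n : ℕ} (z : Fin n → ℤ) (x : Fin n → ℝ) :
    phase z x = 2 * Real.pi * ∑ i, z i * x i := by
  simp [phase, Finset.mul_sum, mul_assoc]

theorem phase_single {n : ℕ} (z : Fin n → ℤ) (i : Fin n) :
    phase z (Pi.single i 1) = 2 * Real.pi * z i := by
  simp [phase_apply, Pi.single_apply]

theorem phase_intCast {n : ℕ} (z m : Fin n → ℤ) :
    phase z (fun i => (m i : ℝ)) = ((∑ i, z i * m i : ℤ) : ℝ) * (2 * Real.pi) := by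
  rw [phase_apply]; push_cast; ring

theorem norm_phase_le {n : ℕ} (z : Fin n → ℤ) (x : Fin n → ℝ) :
    |phase z x| ≤ 2 * Real.pi * n * ‖x‖ * ‖z‖ := by
  rw [phase_apply, abs_mul, abs_of_pos Real.two_pi_pos]
  have : |∑ i, (z i : ℝ) * x i| ≤ n * (‖z‖ * ‖x‖) := by
    refine (Finset.abs_sum_le_sum_abs _ _).trans ?_
    refine (Finset.sum_le_card_nsmul _ _ (‖z‖ * ‖x‖) fun i _ => ?_).trans (by simp)
    rw [abs_mul]
    have h1 : |(z i : ℝ)| ≤ ‖z‖ := by simpa [Int.norm_eq_abs] using norm_le_pi_norm z i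
    have h2 : |x i| ≤ ‖x‖ := by simpa using norm_le_pi_norm x i
    gcongr
  calc _ ≤ 2 * Real.pi * (n * (‖z‖ * ‖x‖)) := by gcongr
    _ = _ := by ring

section Calculus

variable {n : ℕ} {W : Type*} [NormedAddCommGroup W] [NormedSpace ℝ W]

theorem SmoothPeriodic.pderivI {f : (Fin n → ℝ) → W} (hf : SmoothPeriodic f) (i : Fin n) :
    SmoothPeriodic (pderivI i f) := by
  refine ⟨?_, fun x z => ?_⟩
  · have := hf.1.fderiv_right (m := (⊤ : ℕ∞)) (by simp)
    exact this.clm_apply contDiff_const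
  · have h : (fun y => f (y + fun i => (z i : ℝ))) = f := funext fun y => hf.2 y z
    unfold _root_.pderivI
    rw [← fderiv_comp_add_right, h]

/-- The integral over the unit cube of a partial derivative of a periodic function vanishes. -/
theorem SmoothPeriodic.integral_pderivI_eq_zero [CompleteSpace W] {f : (Fin n → ℝ) → W}
    (hf : SmoothPeriodic f) (i : Fin n) :
    ∫ x in Set.Icc (0 : Fin n → ℝ) 1, _root_.pderivI i f x = 0 := by
  cases n with
  | zero => exact i.elim0
  | succ m =>
    have hd : Differentiable ℝ f := hf.1.differentiable (by simp)
    have key := integral_divergence_of_hasFDerivAt_off_countable' (E := W) (n := m)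
      (0 : Fin (m + 1) → ℝ) 1 zero_le_one
      (Pi.single i f) (Pi.single i (fderiv ℝ f)) ∅ Set.countable_empty ?_ ?_ ?_
    · have hsum : ∀ x : Fin (m + 1) → ℝ,
          ∑ j, (Pi.single i (fderiv ℝ f) : Fin (m + 1) → _) j x (Pi.single j 1)
            = _root_.pderivI i f x := by
        intro x
        rw [Finset.sum_eq_single i]
        · simp [_root_.pderivI]
        · intro j _ hj; simp [Pi.single_eq_of_ne hj]
        · simp
      simp only [hsum] at key
      rw [key]
      refine Finset.sum_eq_zero fun j _ => ?_
      rw [sub_eq_zero]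
      congr 1
      ext x
      rcases eq_or_ne j i with rfl | hj
      · simp only [Pi.single_eq_same]
        refine Eq.trans (congrArg f ?_) (hf.2 (j.insertNth ((0 : Fin (m + 1) → ℝ) j) x) (Pi.single j 1))
        ext p
        refine j.succAboveCases ?_ (fun q => ?_) p <;> simp
      · simp [Pi.single_eq_of_ne hj]
    · intro j
      rcases eq_or_ne j i with rfl | hj
      · simpa using hf.1.continuous.continuousOn
      · rw [Pi.single_eq_of_ne hj]; exact continuousOn_const
    · intro x _ j
      rcases eq_or_ne j i with rfl | hj
      · simpa using (hd x).hasFDerivAt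
      · rw [Pi.single_eq_of_ne hj, Pi.single_eq_of_ne hj]; exact hasFDerivAt_const (0 : W) x
    · refine Continuous.integrableOn_Icc (continuous_finsetSum _ fun j _ => ?_)
      rcases eq_or_ne j i with rfl | hj
      · rw [Pi.single_eq_same]; exact (hf.pderivI j).1.continuous
      · simpa [Pi.single_eq_of_ne hj] using continuous_const

theorem SmoothPeriodic.cos_smul {f : (Fin n → ℝ) → W} (hf : SmoothPeriodic f)
    (z : Fin n → ℤ) (θ : ℝ) : SmoothPeriodic fun y => Real.cos (phase z y - θ) • f y := by
  refine ⟨?_, fun x m => ?_⟩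
  · exact (Real.contDiff_cos.comp ((phase z).contDiff.sub contDiff_const)).smul hf.1
  · simp only [hf.2, map_add, phase_intCast]
    rw [add_sub_right_comm, Real.cos_add_int_mul_two_pi]

theorem integrableOn_cos_smul {f : (Fin n → ℝ) → W} (hf : Continuous f) (z : Fin n → ℤ) (θ : ℝ) :
    IntegrableOn (fun y => Real.cos (phase z y - θ) • f y) (Set.Icc 0 1) :=
  Continuous.integrableOn_Icc (by fun_prop)

/-- Integration by parts: differentiation acts on Fourier coefficients as multiplication combined
with a quarter-period phase shift. -/
theorem cubeCoef_pderivI [CompleteSpace W] {f : (Fin n → ℝ) → W} (hf : SmoothPeriodic f)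
    (i : Fin n) (z : Fin n → ℤ) (θ : ℝ) :
    cubeCoef (pderivI i f) z θ = (2 * Real.pi * z i) • cubeCoef f z (θ + Real.pi / 2) := by
  have h0 := (hf.cos_smul z θ).integral_pderivI_eq_zero i
  have hder : ∀ y, pderivI i (fun y => Real.cos (phase z y - θ) • f y) y =
      Real.cos (phase z y - θ) • pderivI i f y -
        (2 * Real.pi * z i) • (Real.cos (phase z y - (θ + Real.pi / 2)) • f y) := by
    intro y
    have hd : HasFDerivAt f (fderiv ℝ f y) y :=
      (hf.1.differentiable (by simp) y).hasFDerivAt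
    have hc := ((phase z).hasFDerivAt (x := y)).sub_const θ |>.cos
    have hs : HasFDerivAt (fun y => Real.cos (phase z y - θ) • f y) _ y := hc.smul hd
    simp only [pderivI]
    rw [hs.fderiv]
    rw [show phase z y - (θ + Real.pi / 2) = phase z y - θ - Real.pi / 2 by ring,
      Real.cos_sub_pi_div_two]
    simp [phase_single, smul_smul]
    module
  simp only [hder] at h0
  rw [integral_sub, integral_smul, sub_eq_zero] at h0
  · exact h0
  · exact integrableOn_cos_smul (hf.pderivI i).1.continuous _ _
  · exact (integrableOn_cos_smul hf.1.continuous _ _).smul (2 * Real.pi * z i)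

theorem norm_cubeCoef_le {f : (Fin n → ℝ) → W} (hf : Continuous f) (z : Fin n → ℤ) (θ : ℝ) :
    ‖cubeCoef f z θ‖ ≤ ∫ y in Set.Icc (0 : Fin n → ℝ) 1, ‖f y‖ := by
  refine (norm_integral_le_integral_norm _).trans
    (integral_mono (integrableOn_cos_smul hf z θ).norm hf.norm.integrableOn_Icc fun y => ?_)
  simp only [norm_smul, Real.norm_eq_abs]
  exact mul_le_of_le_one_left (norm_nonneg _) (Real.abs_cos_le_one _)

theorem cubeCoef_eq {f : (Fin n → ℝ) → W} (hf : Continuous f) (z : Fin n → ℤ) (θ : ℝ) :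
    cubeCoef f z θ =
      Real.cos θ • cubeCoef f z 0 + Real.sin θ • cubeCoef f z (Real.pi / 2) := by
  unfold cubeCoef
  rw [← integral_smul, ← integral_smul, ← integral_add]
  · congr 1
    ext y
    rw [smul_smul, smul_smul, ← add_smul, Real.cos_sub, Real.cos_sub_pi_div_two, sub_zero]
    congr 1
    ring
  · exact (integrableOn_cos_smul hf z 0).smul (Real.cos θ)
  · exact (integrableOn_cos_smul hf z (Real.pi / 2)).smul (Real.sin θ)

theorem hasDerivAt_cubeCoef {f : (Fin n → ℝ) → W} (hf : Continuous f) (z : Fin n → ℤ) (θ : ℝ) :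
    HasDerivAt (cubeCoef f z) (cubeCoef f z (θ + Real.pi / 2)) θ := by
  rw [cubeCoef_eq hf z (θ + Real.pi / 2), Real.cos_add_pi_div_two, Real.sin_add_pi_div_two]
  exact (((Real.hasDerivAt_cos θ).smul_const (cubeCoef f z 0)).add
    ((Real.hasDerivAt_sin θ).smul_const (cubeCoef f z (Real.pi / 2)))).congr_of_eventuallyEq
      (Filter.Eventually.of_forall (cubeCoef_eq hf z))

theorem cubeCoef_add_int_mul_two_pi (f : (Fin n → ℝ) → W) (z : Fin n → ℤ) (θ : ℝ) (m : ℤ) :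
    cubeCoef f z (θ + m * (2 * Real.pi)) = cubeCoef f z θ := by
  unfold cubeCoef
  simp only [← sub_sub, Real.cos_sub_int_mul_two_pi]

theorem iterate_pderivI_cubeCoef [CompleteSpace W] {f : (Fin n → ℝ) → W} (hf : SmoothPeriodic f)
    (i : Fin n) (z : Fin n → ℤ) (N : ℕ) : SmoothPeriodic ((pderivI i)^[N] f) ∧ ∀ θ : ℝ,
      cubeCoef ((pderivI i)^[N] f) z θ =
        (2 * Real.pi * z i) ^ N • cubeCoef f z (θ + N * (Real.pi / 2)) := by
  induction N with
  | zero => simpa using hf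
  | succ N ih =>
    rw [Function.iterate_succ_apply']
    refine ⟨ih.1.pderivI i, fun θ => ?_⟩
    rw [cubeCoef_pderivI ih.1, ih.2, smul_smul]
    push_cast
    ring_nf

/-- Fourier coefficients of smooth periodic functions decay rapidly. -/
theorem SmoothPeriodic.cubeCoef_decay [CompleteSpace W] (hn : 1 ≤ n) {f : (Fin n → ℝ) → W}
    (hf : SmoothPeriodic f) (N : ℕ) :
    ∃ K : ℝ, ∀ (z : Fin n → ℤ) (θ : ℝ), ‖z‖ ^ N * ‖cubeCoef f z θ‖ ≤ K := by
  refine ⟨∑ i, ∫ y in Set.Icc (0 : Fin n → ℝ) 1, ‖(_root_.pderivI i)^[N] f y‖, fun z θ => ?_⟩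
  have : Nonempty (Fin n) := ⟨⟨0, hn⟩⟩
  obtain ⟨i, hi⟩ := Finite.exists_max fun i => ‖z i‖
  have hz : ‖z‖ ≤ |(z i : ℝ)| := by
    have := (pi_norm_le_iff_of_nonneg (norm_nonneg (z i))).2 hi
    simpa [Int.norm_eq_abs] using this
  obtain ⟨h1, h2⟩ := iterate_pderivI_cubeCoef hf i z N
  have h3 := norm_cubeCoef_le h1.1.continuous z (θ - N * (Real.pi / 2))
  rw [h2, sub_add_cancel, norm_smul, norm_pow, norm_mul, Real.norm_of_nonneg Real.two_pi_pos.le,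
    Real.norm_eq_abs] at h3
  calc ‖z‖ ^ N * ‖cubeCoef f z θ‖
      ≤ (2 * Real.pi * |(z i : ℝ)|) ^ N * ‖cubeCoef f z θ‖ := by
        gcongr
        refine hz.trans (le_mul_of_one_le_left (abs_nonneg _) ?_)
        linarith [Real.pi_gt_three]
    _ ≤ _ := h3
    _ ≤ _ := Finset.single_le_sum
        (f := fun i => ∫ y in Set.Icc (0 : Fin n → ℝ) 1, ‖(_root_.pderivI i)^[N] f y‖)
        (fun j _ => integral_nonneg fun _ => norm_nonneg _) (Finset.mem_univ i)

end Calculus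

theorem summable_inv_norm_pow (n : ℕ) : Summable fun z : Fin n → ℤ => (‖z‖⁻¹) ^ (n + 1) := by
  let b := Pi.basisFun ℝ (Fin n)
  let L : Submodule ℤ (Fin n → ℝ) := Submodule.span ℤ (Set.range b)
  have hr : Module.finrank ℤ L = n := by
    rw [ZLattice.rank ℝ L]; simp
  have hs := ZLattice.summable_norm_pow_inv L (n + 1) (by omega)
  have hmem : ∀ z : Fin n → ℤ, (fun i => (z i : ℝ)) ∈ L := fun z => by
    refine (b.mem_span_iff_repr_mem ℤ _).2 fun i => ⟨z i, by simp [b]⟩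
  have hinj : Function.Injective fun z : Fin n → ℤ => (⟨fun i => (z i : ℝ), hmem z⟩ : L) := by
    intro z z' h
    have := congrArg Subtype.val h
    ext i
    exact Int.cast_injective (α := ℝ) (congrFun this i)
  have hnorm : ∀ z : Fin n → ℤ, ‖(⟨fun i => (z i : ℝ), hmem z⟩ : L)‖ = ‖z‖ := fun z => by
    rw [Submodule.coe_norm, Pi.norm_def, Pi.norm_def, NNReal.coe_inj]
    exact Finset.sup_congr rfl fun i _ => NNReal.eq (Int.norm_cast_real (z i))
  have := hs.comp_injective hinj
  simpa only [Function.comp_def, hnorm] using this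

/-- Families `g z` of trigonometric polynomials `θ ↦ cos θ • a z + sin θ • b z` whose size decays
rapidly in `z`. The first condition encodes the shape: differentiation is a quarter-period shift. -/
structure RapidTrig {n : ℕ} {V : Type*} [NormedAddCommGroup V] [NormedSpace ℝ V]
    (g : (Fin n → ℤ) → ℝ → V) : Prop where
  hasDerivAt : ∀ z θ, HasDerivAt (g z) (g z (θ + Real.pi / 2)) θ
  decay : ∀ N : ℕ, ∃ K : ℝ, ∀ (z : Fin n → ℤ) (θ : ℝ), ‖z‖ ^ N * ‖g z θ‖ ≤ K

/-- The Fourier series with modes `x ↦ g z (2π z · x)`. -/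
noncomputable def trigSeries {n : ℕ} {V : Type*} [NormedAddCommGroup V] [NormedSpace ℝ V]
    (g : (Fin n → ℤ) → ℝ → V) (x : Fin n → ℝ) : V :=
  ∑' z, g z (phase z x)

namespace RapidTrig

variable {n : ℕ} {V : Type*} [NormedAddCommGroup V] [NormedSpace ℝ V]
  {g : (Fin n → ℤ) → ℝ → V}

theorem exists_summable_bound (hg : RapidTrig g) :
    ∃ u : (Fin n → ℤ) → ℝ, Summable u ∧ ∀ z θ, ‖g z θ‖ ≤ u z := by
  classical
  obtain ⟨K, hK⟩ := hg.decay (n + 1)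
  obtain ⟨K₀, hK₀⟩ := hg.decay 0
  refine ⟨fun z => K * ‖z‖⁻¹ ^ (n + 1) + if z = 0 then K₀ else 0,
    ((summable_inv_norm_pow n).mul_left K).add
      (summable_of_hasFiniteSupport ((Set.finite_singleton 0).subset fun z hz => ?_)), fun z θ => ?_⟩
  · by_contra h
    exact hz (if_neg h)
  · rcases eq_or_ne z 0 with rfl | hz
    · simpa using hK₀ 0 θ
    · have hz' : 0 < ‖z‖ := norm_pos_iff.2 hz
      beta_reduce
      rw [if_neg hz, add_zero, inv_pow, ← div_eq_mul_inv, le_div_iff₀ (by positivity), mul_comm]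
      exact hK z θ

theorem summable [CompleteSpace V] (hg : RapidTrig g) (x : Fin n → ℝ) :
    Summable fun z => g z (phase z x) := by
  obtain ⟨u, hu, h⟩ := hg.exists_summable_bound
  exact Summable.of_norm_bounded hu fun z => h z _

theorem shift (hg : RapidTrig g) (φ : ℝ) : RapidTrig fun z θ => g z (θ + φ) where
  hasDerivAt z θ := by
    rw [add_right_comm]
    exact (hg.hasDerivAt z (θ + φ)).comp_add_const θ φ
  decay N := by
    obtain ⟨K, hK⟩ := hg.decay N
    exact ⟨K, fun z θ => hK z _⟩

/-- Rapid decay is preserved by linear multipliers of at most linear growth. -/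
theorem clm {W : Type*} [NormedAddCommGroup W] [NormedSpace ℝ W] (hg : RapidTrig g)
    (S : (Fin n → ℤ) → V →L[ℝ] W) (C : ℝ) (hS : ∀ z, ‖S z‖ ≤ C * (1 + ‖z‖)) :
    RapidTrig fun z θ => S z (g z θ) where
  hasDerivAt z θ := (S z).hasFDerivAt.comp_hasDerivAt θ (hg.hasDerivAt z θ)
  decay N := by
    obtain ⟨K, hK⟩ := hg.decay N
    obtain ⟨K', hK'⟩ := hg.decay (N + 1)
    have hC : 0 ≤ C := by
      have := (norm_nonneg _).trans (hS 0)
      simpa using this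
    refine ⟨C * (K + K'), fun z θ => ?_⟩
    have h1 := (S z).le_opNorm (g z θ)
    calc ‖z‖ ^ N * ‖S z (g z θ)‖ ≤ ‖z‖ ^ N * ((C * (1 + ‖z‖)) * ‖g z θ‖) := by
          gcongr
          exact h1.trans (by gcongr; exact hS z)
      _ = C * (‖z‖ ^ N * ‖g z θ‖ + ‖z‖ ^ (N + 1) * ‖g z θ‖) := by ring
      _ ≤ C * (K + K') := by
          gcongr
          · exact hK z θ
          · exact hK' z θ

/-- The family of modes of the directional derivative in direction `y`. -/
theorem deriv (hg : RapidTrig g) (y : Fin n → ℝ) :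
    RapidTrig fun z θ => phase z y • g z (θ + Real.pi / 2) := by
  refine (hg.shift (Real.pi / 2)).clm (fun z => phase z y • ContinuousLinearMap.id ℝ V)
    (2 * Real.pi * n * ‖y‖) fun z => ?_
  refine (norm_smul_le (phase z y) (ContinuousLinearMap.id ℝ V)).trans ?_
  calc ‖phase z y‖ * ‖ContinuousLinearMap.id ℝ V‖
      ≤ (2 * Real.pi * n * ‖y‖ * ‖z‖) * 1 := by
        gcongr
        · exact norm_phase_le z y
        · exact ContinuousLinearMap.norm_id_le
    _ ≤ _ := by
        have : 0 ≤ 2 * Real.pi * n * ‖y‖ := by positivity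
        nlinarith

theorem differentiable_and_fderiv [CompleteSpace V] (hg : RapidTrig g) :
    Differentiable ℝ (trigSeries g) ∧ ∀ x y, fderiv ℝ (trigSeries g) x y =
      trigSeries (fun z θ => phase z y • g z (θ + Real.pi / 2)) x := by
  have hphase : ∀ z : Fin n → ℤ, ‖phase z‖ ≤ 2 * Real.pi * n * (1 + ‖z‖) := fun z => by
    refine ContinuousLinearMap.opNorm_le_bound _ (by positivity) fun y => ?_
    refine (norm_phase_le z y).trans ?_
    have : 0 ≤ 2 * Real.pi * n * ‖y‖ := by positivity
    nlinarith
  have hG : RapidTrig fun z θ => (ContinuousLinearMap.smulRightL ℝ (Fin n → ℝ) V (phase z))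
      (g z (θ + Real.pi / 2)) := by
    refine (hg.shift (Real.pi / 2)).clm _ (2 * Real.pi * n) fun z => ?_
    refine ContinuousLinearMap.opNorm_le_bound _ (by positivity) fun v => ?_
    change ‖(phase z).smulRight v‖ ≤ _
    rw [ContinuousLinearMap.norm_smulRight_apply]
    gcongr
    exact hphase z
  obtain ⟨u, hu, hbd⟩ := hG.exists_summable_bound
  have hder : ∀ x, HasFDerivAt (trigSeries g) (∑' z, ContinuousLinearMap.smulRightL ℝ
      (Fin n → ℝ) V (phase z) (g z (phase z x + Real.pi / 2))) x := fun x => by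
    refine hasFDerivAt_tsum (f := fun z x => g z (phase z x))
      (f' := fun z x => ContinuousLinearMap.smulRightL ℝ (Fin n → ℝ) V (phase z)
        (g z (phase z x + Real.pi / 2)))
      hu (fun z x => ?_) (fun z x => hbd z _) (x₀ := 0) (hg.summable (0 : Fin n → ℝ)) x
    refine ((hg.hasDerivAt z (phase z x)).hasFDerivAt.comp x (phase z).hasFDerivAt).congr_fderiv ?_
    ext y
    simp [ContinuousLinearMap.smulRightL]
  refine ⟨fun x => (hder x).differentiableAt, fun x y => ?_⟩
  rw [(hder x).fderiv]
  exact (ContinuousLinearMap.apply ℝ V y).map_tsum (hG.summable x)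

theorem contDiff [CompleteSpace V] (hg : RapidTrig g) : ContDiff ℝ (⊤ : ℕ∞) (trigSeries g) := by
  rw [contDiff_infty]
  intro m
  induction m generalizing g with
  | zero => exact contDiff_zero.2 hg.differentiable_and_fderiv.1.continuous
  | succ m ih =>
    push_cast
    rw [contDiff_succ_iff_fderiv_apply]
    refine ⟨hg.differentiable_and_fderiv.1, by simp, fun y => ?_⟩
    simp only [hg.differentiable_and_fderiv.2]
    exact ih (hg.deriv y)

theorem pderivI_trigSeries [CompleteSpace V] (hg : RapidTrig g) (i : Fin n) :
    pderivI i (trigSeries g) =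
      trigSeries fun z θ => (2 * Real.pi * z i) • g z (θ + Real.pi / 2) := by
  ext x
  simp only [pderivI, hg.differentiable_and_fderiv.2, phase_single]

theorem pderivI (hg : RapidTrig g) (i : Fin n) :
    RapidTrig fun z θ => (2 * Real.pi * z i) • g z (θ + Real.pi / 2) := by
  simpa only [phase_single] using hg.deriv (Pi.single i 1)

end RapidTrig

/-- Induction over the derivatives making up `∂^α`, tracking the multiplier `(2π z)^α` and
the order `|α|`. -/
theorem partialDerivMulti_induction {n : ℕ} {W : Type*} [NormedAddCommGroup W] [NormedSpace ℝ W]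
    (R : ((Fin n → ℝ) → W) → ((Fin n → ℤ) → ℝ) → ℕ → Prop)
    (hR : ∀ f c m i, R f c m → R (pderivI i f) (fun z => 2 * Real.pi * z i * c z) (m + 1))
    {f : (Fin n → ℝ) → W} (hf : R f (fun _ => 1) 0) (α : Fin n → ℕ) :
    R (partialDerivMulti α f) (fun z => (2 * Real.pi) ^ (∑ i, α i) * ∏ i, (z i : ℝ) ^ α i)
      (∑ i, α i) := by
  have hit : ∀ i N f c m, R f c m →
      R ((pderivI i)^[N] f) (fun z => (2 * Real.pi * z i) ^ N * c z) (m + N) := by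
    intro i N f c m h
    induction N with
    | zero => simpa using h
    | succ N ih =>
      rw [Function.iterate_succ_apply']
      convert hR _ _ _ i ih using 1
      · ext z
        ring
      · omega
  have hl : ∀ l : List (Fin n), R (l.foldr (fun i g => (pderivI i)^[α i] g) f)
      (fun z => (l.map fun i => (2 * Real.pi * (z i : ℝ)) ^ α i).prod) (l.map α).sum := by
    intro l
    induction l with
    | nil => simpa using hf
    | cons i l ih =>
      simp only [List.foldr_cons, List.map_cons, List.prod_cons, List.sum_cons]
      rw [add_comm]
      exact hit i _ _ _ _ ih
  have hsum : (List.map α (List.finRange n)).sum = ∑ i, α i := by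
    rw [Fin.sum_univ_def]
  have hprod : (fun z : Fin n → ℤ => ((List.finRange n).map
      fun i => (2 * Real.pi * (z i : ℝ)) ^ α i).prod) =
      fun z => (2 * Real.pi) ^ (∑ i, α i) * ∏ i, (z i : ℝ) ^ α i := by
    ext z
    rw [← Fin.prod_univ_def]
    simp only [mul_pow, Finset.prod_mul_distrib, Finset.prod_pow_eq_pow_sum]
  rw [← hprod, ← hsum]
  exact hl _

section FourierInversion

variable {n : ℕ} {W : Type*} [NormedAddCommGroup W] [NormedSpace ℝ W] [CompleteSpace W]

theorem SmoothPeriodic.rapidTrig_cubeCoef (hn : 1 ≤ n) {f : (Fin n → ℝ) → W}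
    (hf : SmoothPeriodic f) : RapidTrig (cubeCoef f) :=
  ⟨hasDerivAt_cubeCoef hf.1.continuous, hf.cubeCoef_decay hn⟩

theorem mFourier_coe (z : Fin n → ℤ) (x : Fin n → ℝ) :
    UnitAddTorus.mFourier z (fun i => (x i : UnitAddCircle)) =
      Complex.exp (phase z x * Complex.I) := by
  simp only [UnitAddTorus.mFourier, ContinuousMap.coe_mk, fourier_coe_apply, ← Complex.exp_sum,
    phase_apply]
  congr 1
  push_cast
  rw [Finset.mul_sum, Finset.sum_mul]
  refine Finset.sum_congr rfl fun i _ => ?_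
  ring

theorem setIntegral_Ioc_eq_Icc {E : Type*} [NormedAddCommGroup E] [NormedSpace ℝ E]
    (F : (Fin n → ℝ) → E) :
    ∫ x in {x : Fin n → ℝ | ∀ i, x i ∈ Set.Ioc ((0 : Fin n → ℝ) i) ((0 : Fin n → ℝ) i + 1)}, F x =
      ∫ x in Set.Icc (0 : Fin n → ℝ) 1, F x := by
  refine setIntegral_congr_set ?_
  have := Measure.univ_pi_Ioc_ae_eq_Icc (μ := fun _ : Fin n => (volume : Measure ℝ))
    (f := (0 : Fin n → ℝ)) (g := 1)
  rw [← volume_pi] at this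
  have hset : {x : Fin n → ℝ | ∀ i, x i ∈ Set.Ioc ((0 : Fin n → ℝ) i) ((0 : Fin n → ℝ) i + 1)} =
      Set.univ.pi fun i => Set.Ioc ((0 : Fin n → ℝ) i) ((1 : Fin n → ℝ) i) := by
    ext x
    simp [Set.mem_pi]
  rw [hset]
  exact this

theorem mFourierCoeff_eq_cubeCoef {f : (Fin n → ℝ) → ℝ} (hf : Continuous f)
    {F : UnitAddTorus (Fin n) → ℂ} (hF : ∀ x : Fin n → ℝ, F (fun i => (x i : UnitAddCircle)) = f x)
    (z : Fin n → ℤ) :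
    UnitAddTorus.mFourierCoeff F z =
      ((cubeCoef f z 0 : ℝ) : ℂ) - Complex.I * ((cubeCoef f z (Real.pi / 2) : ℝ) : ℂ) := by
  rw [UnitAddTorus.mFourierCoeff_eq_integral F z 0, setIntegral_Ioc_eq_Icc]
  unfold cubeCoef
  rw [← integral_complex_ofReal, ← integral_complex_ofReal, ← integral_const_mul, ← integral_sub]
  · congr 1
    ext x
    rw [hF, mFourier_coe, show phase (-z) x = -phase z x by simp [phase_apply], smul_eq_mul,
      Complex.ofReal_neg, Complex.exp_mul_I, Complex.cos_neg, Complex.sin_neg, sub_zero,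
      Real.cos_sub_pi_div_two]
    simp only [smul_eq_mul]
    push_cast
    ring
  · exact (integrableOn_cos_smul hf z 0).ofReal
  · exact (integrableOn_cos_smul hf z (Real.pi / 2)).ofReal.const_mul Complex.I

theorem exists_lift_unitAddTorus {f : (Fin n → ℝ) → ℂ} (hf : Continuous f)
    (hper : ∀ (x : Fin n → ℝ) (z : Fin n → ℤ), f (x + fun i => (z i : ℝ)) = f x) :
    ∃ F : C(UnitAddTorus (Fin n), ℂ), ∀ x : Fin n → ℝ, F (fun i => (x i : UnitAddCircle)) = f x := by
  have hq : IsOpenQuotientMap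
      (Pi.map fun (_ : Fin n) (x : ℝ) => (x : UnitAddCircle)) :=
    IsOpenQuotientMap.piMap fun _ => QuotientAddGroup.isOpenQuotientMap_mk
  let q : C(Fin n → ℝ, UnitAddTorus (Fin n)) := ⟨_, hq.continuous⟩
  have hq' : Topology.IsQuotientMap q := hq.isQuotientMap
  have hfac : Function.FactorsThrough (⟨f, hf⟩ : C(Fin n → ℝ, ℂ)) q := by
    intro x y h
    have : ∀ i, ∃ m : ℤ, x i = y i + m := fun i => by
      have hi : ((x i : ℝ) : UnitAddCircle) = (y i : ℝ) := congrFun h i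
      rw [← sub_eq_zero, ← AddCircle.coe_sub, AddCircle.coe_eq_zero_iff] at hi
      obtain ⟨m, hm⟩ := hi
      exact ⟨m, by rw [zsmul_eq_mul, mul_one] at hm; linarith⟩
    choose m hm using this
    change f x = f y
    rw [← hper y m]
    congr 1
    ext i
    exact hm i
  exact ⟨hq'.lift ⟨f, hf⟩ hfac, fun x =>
    DFunLike.congr_fun (hq'.lift_comp ⟨f, hf⟩ hfac) x⟩

theorem SmoothPeriodic.hasSum_cubeCoef_real (hn : 1 ≤ n) {f : (Fin n → ℝ) → ℝ}
    (hf : SmoothPeriodic f) (x : Fin n → ℝ) :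
    HasSum (fun z => cubeCoef f z (phase z x)) (f x) := by
  obtain ⟨F, hF⟩ := exists_lift_unitAddTorus (f := fun x => (f x : ℂ))
    (Complex.continuous_ofReal.comp hf.1.continuous) (fun x z => by rw [hf.2])
  have hcoef := mFourierCoeff_eq_cubeCoef hf.1.continuous hF
  obtain ⟨u, hu, hbd⟩ := (hf.rapidTrig_cubeCoef hn).exists_summable_bound
  have hs : Summable (UnitAddTorus.mFourierCoeff F) := by
    refine Summable.of_norm_bounded (hu.add hu) fun z => ?_
    rw [hcoef]
    refine (norm_sub_le _ _).trans ?_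
    rw [norm_mul, Complex.norm_I, one_mul, Complex.norm_real, Complex.norm_real]
    exact add_le_add (hbd _ _) (hbd _ _)
  have h := Complex.hasSum_re (UnitAddTorus.hasSum_mFourier_series_apply_of_summable hs
    (fun i => (x i : UnitAddCircle)))
  rw [hF, Complex.ofReal_re] at h
  refine h.congr_fun fun z => ?_
  rw [hcoef, mFourier_coe, cubeCoef_eq hf.1.continuous, Complex.exp_mul_I, ← Complex.ofReal_cos,
    ← Complex.ofReal_sin]
  simp [-Complex.ofReal_cos, -Complex.ofReal_sin]
  ring

theorem ContinuousLinearMap.map_cubeCoef {X : Type*} [NormedAddCommGroup X] [NormedSpace ℝ X]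
    [CompleteSpace X] (L : W →L[ℝ] X) {f : (Fin n → ℝ) → W} (hf : Continuous f)
    (z : Fin n → ℤ) (θ : ℝ) : L (cubeCoef f z θ) = cubeCoef (fun x => L (f x)) z θ := by
  unfold cubeCoef
  rw [← L.integral_comp_comm (integrableOn_cos_smul hf z θ)]
  simp

/-- Fourier inversion for smooth periodic functions. -/
theorem SmoothPeriodic.hasSum_cubeCoef (hn : 1 ≤ n) {f : (Fin n → ℝ) → W}
    (hf : SmoothPeriodic f) (x : Fin n → ℝ) :
    HasSum (fun z => cubeCoef f z (phase z x)) (f x) := by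
  have hs := (hf.rapidTrig_cubeCoef hn).summable x
  convert hs.hasSum
  refine (SeparatingDual.eq_iff_forall_dual_eq (R := ℝ)).2 fun L => ?_
  have hL : SmoothPeriodic fun x => L (f x) :=
    ⟨L.contDiff.comp hf.1, fun x z => congrArg L (hf.2 x z)⟩
  refine (hL.hasSum_cubeCoef_real hn x).unique ?_
  simpa only [Function.comp_def, L.map_cubeCoef hf.1.continuous] using L.hasSum hs.hasSum

end FourierInversion

section Symbol

variable {W X : Type*} [NormedAddCommGroup W] [NormedSpace ℝ W]
  [NormedAddCommGroup X] [NormedSpace ℝ X]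

theorem symbolOf_apply {n k : ℕ} (coef : (Fin n → ℕ) → (W →ₗ[ℝ] X)) (ξ : Fin n → ℝ) (c : W) :
    symbolOf k coef ξ c =
      ∑ α ∈ Finset.Nat.antidiagonalTuple n k, (∏ i, ξ i ^ α i) • coef α c := by
  simp [symbolOf]

theorem symbolOf_smul {n k : ℕ} (coef : (Fin n → ℕ) → (W →ₗ[ℝ] X)) (t : ℝ) (ξ : Fin n → ℝ) :
    symbolOf k coef (t • ξ) = t ^ k • symbolOf k coef ξ := by
  unfold symbolOf
  rw [Finset.smul_sum]
  refine Finset.sum_congr rfl fun α hα => ?_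
  rw [Finset.Nat.mem_antidiagonalTuple] at hα
  simp [mul_pow, Finset.prod_mul_distrib, Finset.prod_pow_eq_pow_sum, hα, smul_smul]

theorem continuous_symbolOf {n k : ℕ} [FiniteDimensional ℝ W] (coef : (Fin n → ℕ) → (W →ₗ[ℝ] X)) :
    Continuous fun ξ : Fin n → ℝ => LinearMap.toContinuousLinearMap (symbolOf k coef ξ) := by
  simp only [symbolOf, map_sum, map_smul]
  fun_prop

end Symbol

section Multiplier

variable {V W X : Type*}
  [NormedAddCommGroup V] [InnerProductSpace ℝ V] [FiniteDimensional ℝ V]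
  [NormedAddCommGroup W] [InnerProductSpace ℝ W] [FiniteDimensional ℝ W]
  [NormedAddCommGroup X] [InnerProductSpace ℝ X] [FiniteDimensional ℝ X]

/-- The operator `b b† + a† a` associated to maps `b : V → W` and `a : W → X`. -/
noncomputable def hodgeLaplacian (a : W →L[ℝ] X) (b : V →L[ℝ] W) : W →L[ℝ] W :=
  b ∘L b.adjoint + a.adjoint ∘L a

theorem isUnit_hodgeLaplacian {a : W →L[ℝ] X} {b : V →L[ℝ] W}
    (h : ∀ c, a c = 0 ↔ ∃ v, b v = c) : IsUnit (hodgeLaplacian a b) := by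
  rw [ContinuousLinearMap.isUnit_iff_isUnit_toLinearMap, LinearMap.isUnit_iff_ker_eq_bot,
    LinearMap.ker_eq_bot']
  intro c hc
  have h0 : inner ℝ (hodgeLaplacian a b c) c = ‖b.adjoint c‖ ^ 2 + ‖a c‖ ^ 2 := by
    simp only [hodgeLaplacian, add_apply, ContinuousLinearMap.comp_apply,
      inner_add_left, ContinuousLinearMap.adjoint_inner_left, real_inner_self_eq_norm_sq]
    rw [← ContinuousLinearMap.adjoint_inner_right, real_inner_self_eq_norm_sq]
  have hc' : hodgeLaplacian a b c = 0 := hc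
  rw [hc', inner_zero_left] at h0
  have hb : b.adjoint c = 0 := by
    rw [← norm_eq_zero, ← sq_eq_zero_iff]; nlinarith [sq_nonneg ‖b.adjoint c‖, sq_nonneg ‖a c‖]
  have ha : a c = 0 := by
    rw [← norm_eq_zero, ← sq_eq_zero_iff]; nlinarith [sq_nonneg ‖b.adjoint c‖, sq_nonneg ‖a c‖]
  obtain ⟨v, rfl⟩ := (h c).1 ha
  rw [← inner_self_eq_zero (𝕜 := ℝ), ← ContinuousLinearMap.adjoint_inner_right, hb,
    inner_zero_right]

/-- `b† (b b† + a† a)⁻¹` is a right inverse of `b` on `ker a`. -/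
theorem adjoint_inverse_hodgeLaplacian {a : W →L[ℝ] X} {b : V →L[ℝ] W}
    (h : ∀ c, a c = 0 ↔ ∃ v, b v = c) {c : W} (hc : a c = 0) :
    b ((b.adjoint ∘L Ring.inverse (hodgeLaplacian a b)) c) = c := by
  set y := Ring.inverse (hodgeLaplacian a b) c with hy
  have hLy : b (b.adjoint y) + a.adjoint (a y) = c :=
    DFunLike.congr_fun (Ring.mul_inverse_cancel _ (isUnit_hodgeLaplacian h)) c
  have hab : a (b (b.adjoint y)) = 0 := (h _).2 ⟨_, rfl⟩
  have haa : a (a.adjoint (a y)) = 0 := by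
    rw [← hLy, map_add, hab, zero_add] at hc
    exact hc
  have : a.adjoint (a y) = 0 := by
    rw [← inner_self_eq_zero (𝕜 := ℝ), ContinuousLinearMap.adjoint_inner_left, haa,
      inner_zero_right]
  rw [this, add_zero] at hLy
  exact hLy

/-- Along a compact set on which `a` and `b` are continuous and exact, `b` has uniformly bounded
right inverses on `ker a`. -/
theorem exists_bounded_rightInverse {E : Type*} [TopologicalSpace E] {s : Set E} (hs : IsCompact s)
    {a : E → W →L[ℝ] X} {b : E → V →L[ℝ] W} (ha : Continuous a) (hb : Continuous b)
    (h : ∀ ξ ∈ s, ∀ c, a ξ c = 0 ↔ ∃ v, b ξ v = c) :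
    ∃ K : ℝ, ∀ ξ ∈ s, ∃ S : W →L[ℝ] V, ‖S‖ ≤ K ∧ ∀ c, a ξ c = 0 → b ξ (S c) = c := by
  have hL : Continuous fun ξ => hodgeLaplacian (a ξ) (b ξ) :=
    (hb.clm_comp (ContinuousLinearMap.adjoint.continuous.comp hb)).add
      ((ContinuousLinearMap.adjoint.continuous.comp ha).clm_comp ha)
  have hS : ContinuousOn
      (fun ξ => (b ξ).adjoint ∘L Ring.inverse (hodgeLaplacian (a ξ) (b ξ))) s := by
    refine (ContinuousLinearMap.adjoint.continuous.comp hb).continuousOn.clm_comp fun ξ hξ => ?_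
    obtain ⟨L, hLu⟩ := isUnit_hodgeLaplacian (h ξ hξ)
    have hinv := NormedRing.inverse_continuousAt L
    rw [hLu] at hinv
    exact (ContinuousAt.comp (f := fun ξ => hodgeLaplacian (a ξ) (b ξ)) hinv
      hL.continuousAt).continuousWithinAt
  obtain ⟨K, hK⟩ := hs.exists_bound_of_continuousOn hS
  exact ⟨K, fun ξ hξ => ⟨_, hK ξ hξ, fun c hc => adjoint_inverse_hodgeLaplacian (h ξ hξ) hc⟩⟩

/-- Uniformly bounded Fourier multipliers inverting the differential operator with symbol `B(ξ)`
on the kernel of `A(ξ)`. -/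
theorem exists_multiplier {n k l : ℕ}
    (Acoef : (Fin n → ℕ) → (W →ₗ[ℝ] X)) (Bcoef : (Fin n → ℕ) → (V →ₗ[ℝ] W))
    (hexact : ∀ ξ : Fin n → ℝ, ξ ≠ 0 →
      LinearMap.ker (symbolOf k Acoef ξ) = LinearMap.range (symbolOf l Bcoef ξ)) :
    ∃ (S : (Fin n → ℤ) → W →L[ℝ] V) (C : ℝ), (∀ z, ‖S z‖ ≤ C * (1 + ‖z‖)) ∧
      ∀ z, z ≠ 0 → ∀ c, symbolOf k Acoef (fun i => (z i : ℝ)) c = 0 →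
        (2 * Real.pi) ^ l • symbolOf l Bcoef (fun i => (z i : ℝ)) (S z c) = c := by
  obtain ⟨K, hK⟩ := exists_bounded_rightInverse (isCompact_sphere (0 : Fin n → ℝ) 1)
    (continuous_symbolOf (k := k) Acoef) (continuous_symbolOf (k := l) Bcoef)
    (fun ξ hξ c => by
      have := hexact ξ (ne_zero_of_mem_unit_sphere ⟨ξ, hξ⟩)
      exact (SetLike.ext_iff.1 this c))
  have key : ∀ z : Fin n → ℤ, ∃ S : W →L[ℝ] V, ‖S‖ ≤ |K| * (1 + ‖z‖) ∧
      (z ≠ 0 → ∀ c, symbolOf k Acoef (fun i => (z i : ℝ)) c = 0 →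
        (2 * Real.pi) ^ l • symbolOf l Bcoef (fun i => (z i : ℝ)) (S c) = c) := by
    intro z
    rcases eq_or_ne z 0 with rfl | hz
    · exact ⟨0, by simp, fun h => absurd rfl h⟩
    set ξ : Fin n → ℝ := fun i => (z i : ℝ) with hξ
    have hξ0 : ξ ≠ 0 := fun h => hz (funext fun i => Int.cast_injective (α := ℝ) (by
      simpa [hξ] using congrFun h i))
    have hr : 0 < ‖ξ‖ := norm_pos_iff.2 hξ0
    have hunit : ‖ξ‖⁻¹ • ξ ∈ Metric.sphere (0 : Fin n → ℝ) 1 := by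
      simp [norm_smul, hr.ne']
    have hr1 : 1 ≤ ‖ξ‖ := by
      obtain ⟨i, hi⟩ := Function.ne_iff.1 hz
      refine le_trans ?_ (norm_le_pi_norm ξ i)
      change (1 : ℝ) ≤ |(z i : ℝ)|
      exact_mod_cast Int.one_le_abs hi
    obtain ⟨S, hSK, hS⟩ := hK _ hunit
    have hs0 : 0 < 2 * Real.pi * ‖ξ‖ := by positivity
    refine ⟨((2 * Real.pi * ‖ξ‖) ^ l)⁻¹ • S, ?_, fun _ c hc => ?_⟩
    · rw [norm_smul, norm_inv, norm_pow, Real.norm_of_nonneg hs0.le]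
      have h1 : ((2 * Real.pi * ‖ξ‖) ^ l)⁻¹ ≤ 1 :=
        inv_le_one_of_one_le₀ (one_le_pow₀ (by nlinarith [Real.pi_gt_three]))
      calc _ ≤ 1 * |K| := mul_le_mul h1 (hSK.trans (le_abs_self K)) (norm_nonneg _) zero_le_one
        _ ≤ |K| * (1 + ‖z‖) := by nlinarith [abs_nonneg K, norm_nonneg z]
    · have hc' : LinearMap.toContinuousLinearMap (symbolOf k Acoef (‖ξ‖⁻¹ • ξ)) c = 0 := by
        simp [symbolOf_smul, hc]
      have := hS c hc'
      rw [LinearMap.coe_toContinuousLinearMap', symbolOf_smul, LinearMap.smul_apply] at this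
      rw [smul_apply, map_smul, smul_smul]
      convert this using 2
      rw [mul_pow _ ‖ξ‖, inv_pow]
      field_simp
  choose S hS using key
  exact ⟨S, |K|, fun z => (hS z).1, fun z => (hS z).2⟩

end Multiplier

section DiffOp

variable {n k : ℕ} {W X : Type*}
  [NormedAddCommGroup W] [InnerProductSpace ℝ W] [FiniteDimensional ℝ W]
  [NormedAddCommGroup X] [InnerProductSpace ℝ X]

theorem SmoothPeriodic.cubeCoef_partialDerivMulti {f : (Fin n → ℝ) → W} (hf : SmoothPeriodic f)
    (α : Fin n → ℕ) : SmoothPeriodic (partialDerivMulti α f) ∧ ∀ z θ,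
      cubeCoef (partialDerivMulti α f) z θ = ((2 * Real.pi) ^ (∑ i, α i) * ∏ i, (z i : ℝ) ^ α i) •
        cubeCoef f z (θ + (∑ i, α i : ℕ) * (Real.pi / 2)) := by
  refine partialDerivMulti_induction (fun g c m => SmoothPeriodic g ∧ ∀ z θ,
    cubeCoef g z θ = c z • cubeCoef f z (θ + m * (Real.pi / 2))) ?_ ⟨hf, by simp⟩ α
  rintro g c m i ⟨hg, h⟩
  refine ⟨hg.pderivI i, fun z θ => ?_⟩
  rw [cubeCoef_pderivI hg, h, smul_smul]
  push_cast
  ring_nf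

/-- Fourier coefficients of fields in the kernel of `A` lie in the kernel of the symbol of `A`. -/
theorem symbolOf_cubeCoef_eq_zero [FiniteDimensional ℝ X]
    {f : (Fin n → ℝ) → W} (hf : SmoothPeriodic f) {coef : (Fin n → ℕ) → (W →ₗ[ℝ] X)} (h : ∀ x, diffOp k coef f x = 0) (z : Fin n → ℤ) (θ : ℝ) :
    symbolOf k coef (fun i => (z i : ℝ)) (cubeCoef f z θ) = 0 := by
  set φ := θ - k * (Real.pi / 2) with hφ
  have h0 : ∑ α ∈ Finset.Nat.antidiagonalTuple n k,
      coef α (cubeCoef (partialDerivMulti α f) z φ) = 0 := by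
    have hα : ∀ α, coef α (cubeCoef (partialDerivMulti α f) z φ) =
        ∫ y in Set.Icc (0 : Fin n → ℝ) 1,
          Real.cos (phase z y - φ) • coef α (partialDerivMulti α f y) := fun α =>
      (LinearMap.toContinuousLinearMap (coef α)).map_cubeCoef
        (hf.cubeCoef_partialDerivMulti α).1.1.continuous z φ
    simp only [hα]
    rw [← integral_finsetSum]
    · simp only [← Finset.smul_sum]
      simp only [diffOp] at h
      simp [h]
    · intro α _
      exact integrableOn_cos_smul ((LinearMap.toContinuousLinearMap (coef α)).continuous.comp
        (hf.cubeCoef_partialDerivMulti α).1.1.continuous) z φ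
  have h1 : (2 * Real.pi) ^ k • symbolOf k coef (fun i => (z i : ℝ)) (cubeCoef f z θ) = 0 := by
    rw [← h0, symbolOf_apply, Finset.smul_sum]
    refine Finset.sum_congr rfl fun α hα => ?_
    rw [Finset.Nat.mem_antidiagonalTuple] at hα
    rw [(hf.cubeCoef_partialDerivMulti α).2, hα, hφ, sub_add_cancel, map_smul, smul_smul]
  exact (smul_eq_zero.1 h1).resolve_left (pow_ne_zero _ Real.two_pi_pos.ne')

theorem RapidTrig.partialDerivMulti_trigSeries {g : (Fin n → ℤ) → ℝ → W} (hg : RapidTrig g)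
    (α : Fin n → ℕ) :
    RapidTrig (fun z θ => ((2 * Real.pi) ^ (∑ i, α i) * ∏ i, (z i : ℝ) ^ α i) •
      g z (θ + (∑ i, α i : ℕ) * (Real.pi / 2))) ∧
    partialDerivMulti α (trigSeries g) =
      trigSeries fun z θ => ((2 * Real.pi) ^ (∑ i, α i) * ∏ i, (z i : ℝ) ^ α i) •
        g z (θ + (∑ i, α i : ℕ) * (Real.pi / 2)) := by
  refine partialDerivMulti_induction (fun f c m =>
    RapidTrig (fun z θ => c z • g z (θ + m * (Real.pi / 2))) ∧
      f = trigSeries fun z θ => c z • g z (θ + m * (Real.pi / 2))) ?_ (by simpa using hg) α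
  rintro f c m i ⟨h1, rfl⟩
  have heq : (fun (z : Fin n → ℤ) (θ : ℝ) => (2 * Real.pi * z i * c z) •
      g z (θ + (m + 1 : ℕ) * (Real.pi / 2))) = fun z θ => (2 * Real.pi * z i) •
        c z • g z (θ + Real.pi / 2 + m * (Real.pi / 2)) := by
    ext z θ
    rw [smul_smul]
    push_cast
    ring_nf
  rw [heq]
  exact ⟨h1.pderivI i, h1.pderivI_trigSeries i⟩

/-- Homogeneous differential operators act on Fourier series through their symbols. -/
theorem RapidTrig.diffOp_trigSeries {g : (Fin n → ℤ) → ℝ → W} (hg : RapidTrig g)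
    (coef : (Fin n → ℕ) → (W →ₗ[ℝ] X)) (x : Fin n → ℝ) :
    diffOp k coef (trigSeries g) x = ∑' z, (2 * Real.pi) ^ k •
      symbolOf k coef (fun i => (z i : ℝ)) (g z (phase z x + k * (Real.pi / 2))) := by
  have hα : ∀ α ∈ Finset.Nat.antidiagonalTuple n k,
      HasSum (fun z : Fin n → ℤ => coef α (((2 * Real.pi) ^ k * ∏ i, (z i : ℝ) ^ α i) •
        g z (phase z x + k * (Real.pi / 2)))) (coef α (partialDerivMulti α (trigSeries g) x)) := by
    intro α hα
    rw [Finset.Nat.mem_antidiagonalTuple] at hα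
    obtain ⟨h1, h2⟩ := hg.partialDerivMulti_trigSeries α
    rw [hα] at h1 h2
    rw [h2]
    exact (LinearMap.toContinuousLinearMap (coef α)).hasSum (h1.summable x).hasSum
  rw [diffOp, ← (hasSum_sum hα).tsum_eq]
  refine tsum_congr fun z => ?_
  rw [symbolOf_apply, Finset.smul_sum]
  refine Finset.sum_congr rfl fun α _ => ?_
  rw [map_smul, smul_smul]

end DiffOp


/-- **Periodic fields in the kernel of `A` have potentials.** Let `A`, `B` be homogeneous
constant-coefficient linear differential operators on `ℝ^n` whose symbols have constant
rank on `ℝ^n \ {0}` and satisfy `ker A(ξ) = im B(ξ)` for all `ξ ≠ 0`. Then every smooth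
`ℤ^n`-periodic `w : ℝ^n → W` with `A w = 0` and `∫_{[0,1]^n} w = 0` can be written as
`w = B u` for some smooth `ℤ^n`-periodic `u : ℝ^n → V`. -/
theorem periodic_Afree_field_has_potential
    {n k l : ℕ} (hn : 1 ≤ n) (hk : 1 ≤ k) (hl : 1 ≤ l)
    {V W X : Type*}
    [NormedAddCommGroup V] [InnerProductSpace ℝ V] [FiniteDimensional ℝ V]
    [NormedAddCommGroup W] [InnerProductSpace ℝ W] [FiniteDimensional ℝ W]
    [NormedAddCommGroup X] [InnerProductSpace ℝ X] [FiniteDimensional ℝ X]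
    (Acoef : (Fin n → ℕ) → (W →ₗ[ℝ] X)) (Bcoef : (Fin n → ℕ) → (V →ₗ[ℝ] W))
    (hArank : ∃ r : ℕ, ∀ ξ : Fin n → ℝ, ξ ≠ 0 →
      Module.finrank ℝ (LinearMap.range (symbolOf k Acoef ξ)) = r)
    (hBrank : ∃ s : ℕ, ∀ ξ : Fin n → ℝ, ξ ≠ 0 →
      Module.finrank ℝ (LinearMap.range (symbolOf l Bcoef ξ)) = s)
    (hexact : ∀ ξ : Fin n → ℝ, ξ ≠ 0 →
      LinearMap.ker (symbolOf k Acoef ξ) = LinearMap.range (symbolOf l Bcoef ξ))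
    (w : (Fin n → ℝ) → W)
    (hw_smooth : ContDiff ℝ (⊤ : ℕ∞) w)
    (hw_per : ∀ (x : Fin n → ℝ) (z : Fin n → ℤ), w (x + fun i => (z i : ℝ)) = w x)
    (hw_Afree : ∀ x : Fin n → ℝ, diffOp k Acoef w x = 0)
    (hw_mean : (∫ x in Set.Icc (0 : Fin n → ℝ) 1, w x) = 0) :
    ∃ u : (Fin n → ℝ) → V, ContDiff ℝ (⊤ : ℕ∞) u ∧
      (∀ (x : Fin n → ℝ) (z : Fin n → ℤ), u (x + fun i => (z i : ℝ)) = u x) ∧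
      ∀ x : Fin n → ℝ, w x = diffOp l Bcoef u x := by
  have hw : SmoothPeriodic w := ⟨hw_smooth, hw_per⟩
  obtain ⟨S, C, hSC, hS⟩ := exists_multiplier Acoef Bcoef hexact
  have hg : RapidTrig fun z θ => S z (cubeCoef w z (θ + -(l * (Real.pi / 2)))) :=
    ((hw.rapidTrig_cubeCoef hn).shift (-(l * (Real.pi / 2)))).clm S C hSC
  refine ⟨trigSeries fun z θ => S z (cubeCoef w z (θ + -(l * (Real.pi / 2)))), hg.contDiff,
    fun x m => ?_, fun x => ?_⟩
  · refine tsum_congr fun z => ?_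
    beta_reduce
    rw [map_add, phase_intCast, add_right_comm, cubeCoef_add_int_mul_two_pi]
  · rw [hg.diffOp_trigSeries, ← (hw.hasSum_cubeCoef hn x).tsum_eq]
    refine tsum_congr fun z => ?_
    rw [add_neg_cancel_right]
    rcases eq_or_ne z 0 with rfl | hz
    · have h0 : cubeCoef w 0 (phase 0 x) = 0 := by
        simp [cubeCoef, phase_apply, hw_mean]
      rw [h0, map_zero, map_zero, smul_zero]
    · exact (hS z hz _ (symbolOf_cubeCoef_eq_zero hw hw_Afree z _)).symm
end

section
/- Let A and B be homogeneous constant-coefficient linear differential operators on ℝ^n of orders k and l respectively (A from W to X, B from V to W), both of constant rank, with ker A(ξ) = im B(ξ) for all ξ ∈ ℝ^n \ {0}, and let f : W → ℝ be Borel measurable and locally bounded. For η ∈ W define Q_A f(η) := inf{ ∫_{[0,1]^n} f(η + w(x)) dx : w : ℝ^n → W smooth, ℤ^n-periodic, A w = 0, ∫_{[0,1]^n} w(x) dx = 0 } and Q^B f(η) := inf{ ∫_{[0,1]^n} f(η + B u(x)) dx : u ∈ C_c^∞((0,1)^n, V) }, where the infima take values in ℝ ∪ {−∞}. Then Q_A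 f(η) = Q^B f(η) for all η ∈ W. -/
open MeasureTheory
open scoped BigOperators

/-- The open unit cube `(0,1)^n`. -/
def openUnitCube (n : ℕ) : Set (Fin n → ℝ) := Set.univ.pi fun _ => Set.Ioo (0 : ℝ) 1

/-- The `A`-quasiconvex envelope at `η`: the infimum (in `ℝ ∪ {±∞}`, realized in `EReal`)
of `∫_{[0,1]^n} f(η + w(x)) dx` over all smooth `ℤ^n`-periodic `w` with `A w = 0` and
zero mean over the unit cube. -/
noncomputable def QAenv {n k : ℕ} {W X : Type*}
    [NormedAddCommGroup W] [NormedSpace ℝ W] [NormedAddCommGroup X] [NormedSpace ℝ X]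
    (Acoef : (Fin n → ℕ) → (W →ₗ[ℝ] X)) (f : W → ℝ) (η : W) : EReal :=
  sInf {y : EReal | ∃ w : (Fin n → ℝ) → W, ContDiff ℝ (⊤ : ℕ∞) w ∧
    (∀ (x : Fin n → ℝ) (z : Fin n → ℤ), w (x + fun i => (z i : ℝ)) = w x) ∧
    (∀ x : Fin n → ℝ, diffOp k Acoef w x = 0) ∧
    (∫ x in Set.Icc (0 : Fin n → ℝ) 1, w x) = 0 ∧
    y = ((∫ x in Set.Icc (0 : Fin n → ℝ) 1, f (η + w x)) : ℝ)}

/-- The `B`-quasiconvex envelope at `η`: the infimum (in `EReal`) of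
`∫_{[0,1]^n} f(η + B u(x)) dx` over all `u ∈ C_c^∞((0,1)^n, V)`. -/
noncomputable def QBenv {n l : ℕ} {V W : Type*}
    [NormedAddCommGroup V] [NormedSpace ℝ V] [NormedAddCommGroup W] [NormedSpace ℝ W]
    (Bcoef : (Fin n → ℕ) → (V →ₗ[ℝ] W)) (f : W → ℝ) (η : W) : EReal :=
  sInf {y : EReal | ∃ u : (Fin n → ℝ) → V, ContDiff ℝ (⊤ : ℕ∞) u ∧
    tsupport u ⊆ openUnitCube n ∧
    y = ((∫ x in Set.Icc (0 : Fin n → ℝ) 1, f (η + diffOp l Bcoef u x)) : ℝ)}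

namespace PeriodicDiffOp

section Basic

variable {n : ℕ} {V W X : Type*}
  [NormedAddCommGroup V] [NormedSpace ℝ V]
  [NormedAddCommGroup W] [NormedSpace ℝ W]
  [NormedAddCommGroup X] [NormedSpace ℝ X]

/-- The list of directions encoded by a multi-index, in the order used by `partialDerivMulti`. -/
def directions (α : Fin n → ℕ) : List (Fin n) :=
  (List.finRange n).flatMap fun i => List.replicate (α i) i

lemma foldr_replicate_eq_iterate {α β : Type*} (g : α → β → β) (a : α) (b : β) (m : ℕ) :
    (List.replicate m a).foldr g b = (g a)^[m] b := by
  induction m with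
  | zero => rfl
  | succ m ih => rw [List.replicate_succ, List.foldr_cons, ih, Function.iterate_succ_apply']

lemma partialDerivMulti_eq_foldr (α : Fin n → ℕ) (f : (Fin n → ℝ) → W) :
    partialDerivMulti α f = (directions α).foldr pderivI f := by
  unfold partialDerivMulti directions
  induction List.finRange n with
  | nil => rfl
  | cons i L ih =>
    rw [List.foldr_cons, ih, List.flatMap_cons, List.foldr_append, foldr_replicate_eq_iterate]

lemma length_directions (α : Fin n → ℕ) : (directions α).length = ∑ i, α i := by
  simp [directions, List.length_flatMap, ← List.ofFn_eq_map, List.sum_ofFn]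

lemma prod_map_directions {M : Type*} [CommMonoid M] (α : Fin n → ℕ) (ξ : Fin n → M) :
    ((directions α).map ξ).prod = ∏ i, ξ i ^ α i := by
  rw [directions, List.map_flatMap, List.flatMap, List.prod_flatten, List.map_map,
    ← List.ofFn_eq_map, List.prod_ofFn]
  simp

lemma length_directions_of_mem {k : ℕ} {α : Fin n → ℕ}
    (hα : α ∈ Finset.Nat.antidiagonalTuple n k) : (directions α).length = k := by
  rw [length_directions, Finset.Nat.mem_antidiagonalTuple.mp hα]

lemma contDiff_pderivI {f : (Fin n → ℝ) → W} (hf : ContDiff ℝ (⊤ : ℕ∞) f) (i : Fin n) :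
    ContDiff ℝ (⊤ : ℕ∞) (pderivI i f) :=
  (hf.fderiv_right (m := ((⊤ : ℕ∞) : WithTop ℕ∞)) (by simp)).clm_apply contDiff_const

lemma contDiff_foldr_pderivI {f : (Fin n → ℝ) → W} (hf : ContDiff ℝ (⊤ : ℕ∞) f)
    (L : List (Fin n)) : ContDiff ℝ (⊤ : ℕ∞) (L.foldr pderivI f) := by
  induction L with
  | nil => exact hf
  | cons i L ih => exact contDiff_pderivI ih i

lemma foldr_pderivI_eventuallyEq {f g : (Fin n → ℝ) → W} {x : Fin n → ℝ} (h : f =ᶠ[nhds x] g)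
    (L : List (Fin n)) : L.foldr pderivI f =ᶠ[nhds x] L.foldr pderivI g := by
  induction L with
  | nil => exact h
  | cons i L ih => exact (ih.fderiv (𝕜 := ℝ)).mono fun y hy => by simp [pderivI, hy]

lemma foldr_pderivI_comp_smul {f : (Fin n → ℝ) → W} (hf : ContDiff ℝ (⊤ : ℕ∞) f) (c : ℝ)
    (L : List (Fin n)) :
    L.foldr pderivI (fun x => f (c • x)) = fun x => c ^ L.length • L.foldr pderivI f (c • x) := by
  induction L with
  | nil => simp
  | cons i L ih =>
    ext x
    have hg : ContDiff ℝ (⊤ : ℕ∞) (L.foldr pderivI f) := contDiff_foldr_pderivI hf L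
    have hd : Differentiable ℝ (fun x : Fin n → ℝ => L.foldr pderivI f (c • x)) :=
      (hg.differentiable (by simp)).comp (differentiable_id.const_smul c)
    rw [List.foldr_cons, ih, pderivI, fderiv_fun_const_smul hd.differentiableAt]
    rw [fderiv_comp_smul]
    simp [pderivI, pow_succ, mul_smul]

lemma foldr_pderivI_const_smul {f : (Fin n → ℝ) → W} (hf : ContDiff ℝ (⊤ : ℕ∞) f) (c : ℝ)
    (L : List (Fin n)) :
    L.foldr pderivI (fun x => c • f x) = fun x => c • L.foldr pderivI f x := by
  induction L with
  | nil => rfl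
  | cons i L ih =>
    ext x
    rw [List.foldr_cons, ih, pderivI, fderiv_fun_const_smul
      ((contDiff_foldr_pderivI hf L).differentiable (by simp)).differentiableAt]
    rfl

lemma foldr_pderivI_comp_add_right (f : (Fin n → ℝ) → W) (a : Fin n → ℝ) (L : List (Fin n)) :
    L.foldr pderivI (fun x => f (x + a)) = fun x => L.foldr pderivI f (x + a) := by
  induction L with
  | nil => rfl
  | cons i L ih =>
    ext x
    rw [List.foldr_cons, ih, pderivI, fderiv_comp_add_right]
    rfl

lemma norm_iteratedFDeriv_pderivI_le {f : (Fin n → ℝ) → W} (hf : ContDiff ℝ (⊤ : ℕ∞) f)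
    (i : Fin n) (m : ℕ) (x : Fin n → ℝ) :
    ‖iteratedFDeriv ℝ m (pderivI i f) x‖ ≤ ‖iteratedFDeriv ℝ (m + 1) f x‖ := by
  have hf' : ContDiff ℝ (⊤ : ℕ∞) (fderiv ℝ f) := hf.fderiv_right (by simp)
  have h := (ContinuousLinearMap.apply ℝ W
    (Pi.single i 1 : Fin n → ℝ)).norm_iteratedFDeriv_comp_left
    (hf'.contDiffAt (x := x)) (n := m) (by exact_mod_cast le_top)
  rw [norm_iteratedFDeriv_fderiv] at h
  refine h.trans (mul_le_of_le_one_left (norm_nonneg _) ?_)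
  refine ContinuousLinearMap.opNorm_le_bound _ zero_le_one fun A => ?_
  rw [ContinuousLinearMap.apply_apply, one_mul]
  refine (A.le_opNorm _).trans (mul_le_of_le_one_right (norm_nonneg _) ?_)
  exact (pi_norm_le_iff_of_nonneg zero_le_one).mpr fun j => by
    by_cases hj : j = i
    · subst hj; simp
    · simp [Pi.single_eq_of_ne hj]

lemma norm_iteratedFDeriv_foldr_pderivI_le {f : (Fin n → ℝ) → W} (hf : ContDiff ℝ (⊤ : ℕ∞) f)
    (L : List (Fin n)) (m : ℕ) (x : Fin n → ℝ) :
    ‖iteratedFDeriv ℝ m (L.foldr pderivI f) x‖ ≤ ‖iteratedFDeriv ℝ (m + L.length) f x‖ := by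
  induction L generalizing m with
  | nil => exact le_rfl
  | cons i L ih =>
    refine (norm_iteratedFDeriv_pderivI_le (contDiff_foldr_pderivI hf L) i m x).trans
      ((ih (m + 1)).trans_eq ?_)
    rw [List.length_cons, add_right_comm, add_assoc]

section Operator

variable {k : ℕ} (A : (Fin n → ℕ) → (W →ₗ[ℝ] X))

lemma diffOp_apply (f : (Fin n → ℝ) → W) (x : Fin n → ℝ) :
    diffOp k A f x = ∑ α ∈ Finset.Nat.antidiagonalTuple n k,
      A α ((directions α).foldr pderivI f x) := by
  simp [diffOp, partialDerivMulti_eq_foldr]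

lemma contDiff_diffOp [FiniteDimensional ℝ W] {f : (Fin n → ℝ) → W}
    (hf : ContDiff ℝ (⊤ : ℕ∞) f) : ContDiff ℝ (⊤ : ℕ∞) (diffOp k A f) := by
  have h : diffOp k A f = fun x => ∑ α ∈ Finset.Nat.antidiagonalTuple n k,
      LinearMap.toContinuousLinearMap (A α) ((directions α).foldr pderivI f x) := by
    ext x; simp [diffOp_apply]
  rw [h]
  exact ContDiff.sum fun α _ =>
    (LinearMap.toContinuousLinearMap (A α)).contDiff.comp (contDiff_foldr_pderivI hf _)

lemma diffOp_congr {f g : (Fin n → ℝ) → W} {x : Fin n → ℝ} (h : f =ᶠ[nhds x] g) :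
    diffOp k A f x = diffOp k A g x := by
  simp [diffOp_apply, fun L => (foldr_pderivI_eventuallyEq h L).self_of_nhds]

lemma diffOp_rescale {f : (Fin n → ℝ) → W} (hf : ContDiff ℝ (⊤ : ℕ∞) f) {c : ℝ} (hc : c ≠ 0)
    (x : Fin n → ℝ) :
    diffOp k A (fun y => (c ^ k)⁻¹ • f (c • y)) x = diffOp k A f (c • x) := by
  rw [diffOp_apply, diffOp_apply]
  refine Finset.sum_congr rfl fun α hα => ?_
  have hf' : ContDiff ℝ (⊤ : ℕ∞) (fun y => f (c • y)) := hf.comp (contDiff_const_smul c)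
  rw [foldr_pderivI_const_smul hf', foldr_pderivI_comp_smul hf, length_directions_of_mem hα]
  simp [smul_smul, inv_mul_cancel₀ (pow_ne_zero k hc)]

lemma diffOp_comp_add_right (f : (Fin n → ℝ) → W) (a x : Fin n → ℝ) :
    diffOp k A (fun y => f (y + a)) x = diffOp k A f (x + a) := by
  simp [diffOp_apply, foldr_pderivI_comp_add_right]

lemma exists_norm_diffOp_le [FiniteDimensional ℝ W] :
    ∃ C : ℝ, 0 ≤ C ∧ ∀ f : (Fin n → ℝ) → W, ContDiff ℝ (⊤ : ℕ∞) f → ∀ x,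
      ‖diffOp k A f x‖ ≤ C * ‖iteratedFDeriv ℝ k f x‖ := by
  refine ⟨∑ α ∈ Finset.Nat.antidiagonalTuple n k, ‖LinearMap.toContinuousLinearMap (A α)‖,
    Finset.sum_nonneg fun _ _ => norm_nonneg _, fun f hf x => ?_⟩
  rw [diffOp_apply, Finset.sum_mul]
  refine norm_sum_le_of_le _ fun α hα => ?_
  refine ((LinearMap.toContinuousLinearMap (A α)).le_opNorm _).trans ?_
  gcongr
  have h := norm_iteratedFDeriv_foldr_pderivI_le hf (directions α) 0 x
  rwa [norm_iteratedFDeriv_zero, zero_add, length_directions_of_mem hα] at h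

end Operator

end Basic

section Fourier

variable {n : ℕ} {V W X : Type*}
  [NormedAddCommGroup V] [NormedSpace ℝ V]
  [NormedAddCommGroup W] [NormedSpace ℝ W]
  [NormedAddCommGroup X] [NormedSpace ℝ X]

/-- Periodicity with respect to the integer lattice. -/
def LatticePeriodic {E : Type*} (f : (Fin n → ℝ) → E) : Prop :=
  ∀ (x : Fin n → ℝ) (z : Fin n → ℤ), f (x + fun i => (z i : ℝ)) = f x

lemma LatticePeriodic.foldr_pderivI {f : (Fin n → ℝ) → W} (hf : LatticePeriodic f)
    (L : List (Fin n)) : LatticePeriodic (L.foldr pderivI f) := fun x z => by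
  rw [← congrFun (foldr_pderivI_comp_add_right f (fun i => (z i : ℝ)) L) x, funext fun y => hf y z]

lemma LatticePeriodic.diffOp {f : (Fin n → ℝ) → W} (hf : LatticePeriodic f) {k : ℕ}
    (A : (Fin n → ℕ) → (W →ₗ[ℝ] X)) : LatticePeriodic (diffOp k A f) := fun x z => by
  rw [← diffOp_comp_add_right, funext fun y => hf y z]

lemma LatticePeriodic.eq_fract {E : Type*} {f : (Fin n → ℝ) → E} (hf : LatticePeriodic f)
    (x : Fin n → ℝ) : f x = f fun i => Int.fract (x i) := by
  rw [← hf (fun i => Int.fract (x i)) fun i => ⌊x i⌋]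
  congr 1
  ext i
  simp [Int.fract_add_floor]

lemma LatticePeriodic.exists_norm_le {E : Type*} [NormedAddCommGroup E] {f : (Fin n → ℝ) → E}
    (hf : LatticePeriodic f) (hc : Continuous f) : ∃ C : ℝ, 0 ≤ C ∧ ∀ x, ‖f x‖ ≤ C := by
  obtain ⟨C, hC⟩ := (isCompact_Icc (a := (0 : Fin n → ℝ)) (b := 1)).exists_bound_of_continuousOn
    hc.continuousOn
  have h : ∀ x, ‖f x‖ ≤ C := fun x => by
    rw [hf.eq_fract]
    exact hC _ ⟨fun i => Int.fract_nonneg _, fun i => (Int.fract_lt_one _).le⟩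
  exact ⟨C, (norm_nonneg _).trans (h 0), h⟩

/-- The linear phase `x ↦ 2π ⟨m, x⟩`. -/
noncomputable def phase (m : Fin n → ℤ) : (Fin n → ℝ) →L[ℝ] ℝ :=
  ∑ j, (2 * Real.pi * m j) • ContinuousLinearMap.proj (R := ℝ) (φ := fun _ : Fin n => ℝ) j

lemma phase_apply (m : Fin n → ℤ) (x : Fin n → ℝ) :
    phase m x = ∑ j, 2 * Real.pi * m j * x j := by
  simp [phase]

lemma phase_single (m : Fin n → ℤ) (j : Fin n) :
    phase m (Pi.single j 1) = 2 * Real.pi * m j := by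
  simp [phase_apply, Pi.single_apply]

/-- The exponential mode `x ↦ exp (2π i ⟨m, x⟩)`. -/
noncomputable def wave (m : Fin n → ℤ) (x : Fin n → ℝ) : ℂ :=
  Complex.exp (phase m x * Complex.I)

lemma norm_wave (m : Fin n → ℤ) (x : Fin n → ℝ) : ‖wave m x‖ = 1 :=
  Complex.norm_exp_ofReal_mul_I _

lemma mFourier_eq_wave (m : Fin n → ℤ) (x : Fin n → ℝ) :
    UnitAddTorus.mFourier m (fun i => (x i : UnitAddCircle)) = wave m x := by
  simp only [UnitAddTorus.mFourier, ContinuousMap.coe_mk, fourier_coe_apply, wave, phase_apply,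
    ← Complex.exp_sum]
  congr 1
  push_cast
  rw [Finset.sum_mul]
  exact Finset.sum_congr rfl fun i _ => by ring

lemma latticePeriodic_wave (m : Fin n → ℤ) : LatticePeriodic (wave m) := fun x z => by
  rw [← mFourier_eq_wave, ← mFourier_eq_wave]
  congr 1
  ext i
  simp

lemma hasFDerivAt_wave (m : Fin n → ℤ) (x : Fin n → ℝ) :
    HasFDerivAt (wave m) ((phase m).smulRight (Complex.I * wave m x)) x := by
  have h := (((Complex.ofRealCLM.hasFDerivAt (x := phase m x)).comp x
    (phase m).hasFDerivAt).mul_const Complex.I).cexp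
  refine h.congr_fderiv ?_
  ext y
  simp [wave]
  ring

lemma contDiff_wave (m : Fin n → ℤ) : ContDiff ℝ (⊤ : ℕ∞) (wave m) :=
  ((Complex.ofRealCLM.contDiff.comp (phase m).contDiff).mul contDiff_const).cexp

/-- Multiplication by a complex number, as a real-linear map. -/
noncomputable def mulC (a : ℂ) : ℂ →L[ℝ] ℂ := ContinuousLinearMap.mul ℝ ℂ a

@[simp] lemma mulC_apply (a z : ℂ) : mulC a z = a * z := rfl

lemma norm_mulC_le (a : ℂ) : ‖mulC a‖ ≤ ‖a‖ :=
  ContinuousLinearMap.opNorm_le_bound _ (norm_nonneg _) fun z => (norm_mul a z).le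

/-- The real functional `z ↦ Re (conj (wave m x) * z)`. -/
noncomputable def wavePairing (m : Fin n → ℤ) (x : Fin n → ℝ) : ℂ →L[ℝ] ℝ :=
  Complex.reCLM ∘L mulC ((starRingEnd ℂ) (wave m x))

lemma wavePairing_apply (m : Fin n → ℤ) (x : Fin n → ℝ) (z : ℂ) :
    wavePairing m x z = ((starRingEnd ℂ) (wave m x) * z).re := rfl

lemma continuous_wavePairing (m : Fin n → ℤ) : Continuous (wavePairing m) := by
  have h : Continuous fun x => (starRingEnd ℂ) (wave m x) :=
    Complex.continuous_conj.comp (contDiff_wave m).continuous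
  exact continuous_const.clm_comp ((ContinuousLinearMap.mul ℝ ℂ).continuous.comp h)

lemma norm_wavePairing_le (m : Fin n → ℤ) (x : Fin n → ℝ) : ‖wavePairing m x‖ ≤ 1 :=
  ContinuousLinearMap.opNorm_le_bound _ zero_le_one fun z => by
    rw [wavePairing_apply, Real.norm_eq_abs]
    refine (Complex.abs_re_le_norm _).trans_eq ?_
    rw [norm_mul, RCLike.norm_conj, norm_wave]

/-- The `m`-th Fourier coefficient of a vector-valued function `w`, encoded as the real-linear map
`z ↦ ∫ Re (conj (wave m x) * z) • w x`. -/
noncomputable def fourierMap (w : (Fin n → ℝ) → W) (m : Fin n → ℤ) : ℂ →L[ℝ] W :=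
  ∫ x in Set.Icc (0 : Fin n → ℝ) 1, (wavePairing m x).smulRight (w x)

lemma integrableOn_cube {E : Type*} [NormedAddCommGroup E] {g : (Fin n → ℝ) → E}
    (hg : Continuous g) : IntegrableOn g (Set.Icc (0 : Fin n → ℝ) 1) :=
  hg.continuousOn.integrableOn_compact isCompact_Icc

lemma continuous_fourierMap_integrand {w : (Fin n → ℝ) → W} (hw : Continuous w)
    (m : Fin n → ℤ) : Continuous fun x => (wavePairing m x).smulRight (w x) :=
  ((ContinuousLinearMap.smulRightL ℝ ℂ W).continuous.comp (continuous_wavePairing m)).clm_apply hw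

lemma volume_real_cube : volume.real (Set.Icc (0 : Fin n → ℝ) 1) = 1 := by
  simp [Measure.real, Real.volume_Icc_pi]

lemma fourierMap_apply {w : (Fin n → ℝ) → W} (hw : Continuous w) (m : Fin n → ℤ) (z : ℂ) :
    fourierMap w m z = ∫ x in Set.Icc (0 : Fin n → ℝ) 1, wavePairing m x z • w x := by
  rw [fourierMap, ContinuousLinearMap.integral_apply
    (integrableOn_cube (continuous_fourierMap_integrand hw m))]
  rfl

lemma norm_fourierMap_le {w : (Fin n → ℝ) → W} {C : ℝ} (hC : ∀ x, ‖w x‖ ≤ C) (m : Fin n → ℤ) :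
    ‖fourierMap w m‖ ≤ C := by
  refine (norm_setIntegral_le_of_norm_le_const (C := C)
    (by simp [Real.volume_Icc_pi]) fun x _ => ?_).trans_eq ?_
  · rw [ContinuousLinearMap.norm_smulRight_apply]
    exact (mul_le_of_le_one_left (norm_nonneg _) (norm_wavePairing_le m x)).trans (hC x)
  · rw [volume_real_cube, mul_one]

lemma integral_pderivI_eq_zero {g : (Fin n → ℝ) → W} (hg : ContDiff ℝ (⊤ : ℕ∞) g)
    (hp : LatticePeriodic g) (j : Fin n) :
    ∫ x in Set.Icc (0 : Fin n → ℝ) 1, pderivI j g x = 0 := by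
  cases n with
  | zero => exact j.elim0
  | succ n =>
    have hgd : ∀ x, HasFDerivAt g (fderiv ℝ g x) x := fun x =>
      (hg.differentiable (by simp) x).hasFDerivAt
    have hsum : ∀ x, ∑ i : Fin (n + 1), (if i = j then fderiv ℝ g x else 0) (Pi.single i 1)
        = pderivI j g x := fun x => by
      rw [Finset.sum_eq_single j]
      · simp [pderivI]
      · intro i _ hij; simp [hij]
      · simp
    have h := integral_divergence_of_hasFDerivAt_off_countable' (0 : Fin (n + 1) → ℝ) 1
      zero_le_one (fun i => if i = j then g else 0)
      (fun i x => if i = j then fderiv ℝ g x else 0) ∅ Set.countable_empty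
      (fun i => by
        by_cases hij : i = j
        · simp only [hij, if_true]; exact hg.continuous.continuousOn
        · simp only [hij, if_false]; exact continuousOn_const)
      (fun x _ i => by
        by_cases hij : i = j
        · simp only [hij, if_true]; exact hgd x
        · simp only [hij, if_false]; exact hasFDerivAt_const 0 x)
      (by
        simp only [hsum]
        exact integrableOn_cube (contDiff_pderivI hg j).continuous)
    simp only [hsum] at h
    rw [h]
    refine Finset.sum_eq_zero fun i _ => ?_
    by_cases hij : i = j
    · subst hij
      simp only [if_true]
      rw [sub_eq_zero]
      refine integral_congr_ae (Filter.Eventually.of_forall fun x => ?_)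
      have := hp (i.insertNth ((0 : Fin (n + 1) → ℝ) i) x) (Pi.single i 1)
      simp only
      rw [← this]
      congr 1
      ext l
      refine Fin.succAboveCases i ?_ (fun l => ?_) l
      · simp
      · simp
    · simp [hij]

end Fourier

section FourierSeries

variable {n : ℕ} {V W X : Type*}
  [NormedAddCommGroup V] [NormedSpace ℝ V]
  [NormedAddCommGroup W] [NormedSpace ℝ W]
  [NormedAddCommGroup X] [NormedSpace ℝ X]

lemma fourierMap_pderivI {w : (Fin n → ℝ) → W} (hw : ContDiff ℝ (⊤ : ℕ∞) w)
    (hp : LatticePeriodic w) (j : Fin n) (m : Fin n → ℤ) (z : ℂ) :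
    fourierMap (pderivI j w) m z =
      (2 * Real.pi * m j) • fourierMap w m (Complex.I * z) := by
  have hdw := contDiff_pderivI hw j
  rw [fourierMap_apply hdw.continuous, fourierMap_apply hw.continuous, ← integral_smul]
  have hpair : ∀ x, HasFDerivAt (fun x => wavePairing m x z)
      ((-1 : ℝ) • (phase m).smulRight (wavePairing m x (Complex.I * z))) x := fun x => by
    have h := ((Complex.reCLM ∘L mulC z ∘L
      (Complex.conjCLE : ℂ →L[ℝ] ℂ)).hasFDerivAt (x := wave m x)).comp x (hasFDerivAt_wave m x)
    refine (h.congr_fderiv ?_).congr_of_eventuallyEq (Filter.Eventually.of_forall fun y => ?_)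
    · ext y
      simp [wavePairing_apply]
      ring
    · simp [wavePairing_apply]
      ring
  have hpc : ContDiff ℝ (⊤ : ℕ∞) fun x => wavePairing m x z := by
    have h := (Complex.reCLM ∘L mulC z ∘L
      (Complex.conjCLE : ℂ →L[ℝ] ℂ)).contDiff.comp (contDiff_wave m)
    convert! h using 2 with x
    simp [wavePairing_apply]
    ring
  have hg : ContDiff ℝ (⊤ : ℕ∞) fun x => wavePairing m x z • w x := hpc.smul hw
  have hgp : LatticePeriodic fun x => wavePairing m x z • w x := fun x y => by
    simp only [wavePairing_apply]
    rw [hp, latticePeriodic_wave]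
  have key := integral_pderivI_eq_zero hg hgp j
  have hderiv : ∀ x, pderivI j (fun x => wavePairing m x z • w x) x =
      wavePairing m x z • pderivI j w x
        - (2 * Real.pi * m j) • wavePairing m x (Complex.I * z) • w x := fun x => by
    rw [pderivI, ((hpair x).fun_smul ((hw.differentiable (by simp)) x).hasFDerivAt).fderiv]
    simp [pderivI, phase_single, smul_smul, sub_eq_add_neg]
  have hc : ∀ z, Continuous fun x => wavePairing m x z := fun z =>
    (continuous_wavePairing m).clm_apply continuous_const
  simp only [hderiv] at key
  have hi₁ : IntegrableOn (fun x => wavePairing m x z • pderivI j w x)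
      (Set.Icc (0 : Fin n → ℝ) 1) := integrableOn_cube ((hc _).smul hdw.continuous)
  have hi₂ : IntegrableOn (fun x => (2 * Real.pi * m j) • wavePairing m x (Complex.I * z) • w x)
      (Set.Icc (0 : Fin n → ℝ) 1) :=
    integrableOn_cube (((hc _).smul hw.continuous).const_smul _)
  rwa [integral_sub hi₁ hi₂, sub_eq_zero] at key

lemma fourierMap_foldr_pderivI {w : (Fin n → ℝ) → W} (hw : ContDiff ℝ (⊤ : ℕ∞) w)
    (hp : LatticePeriodic w) (L : List (Fin n)) (m : Fin n → ℤ) (z : ℂ) :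
    fourierMap (L.foldr pderivI w) m z =
      (L.map fun j => 2 * Real.pi * m j).prod • fourierMap w m (Complex.I ^ L.length * z) := by
  induction L generalizing z with
  | nil => simp
  | cons j L ih =>
    rw [List.foldr_cons, fourierMap_pderivI (contDiff_foldr_pderivI hw L) (hp.foldr_pderivI L),
      ih, smul_smul]
    simp [pow_succ, mul_assoc]

lemma prod_map_two_pi_mul {k : ℕ} {α : Fin n → ℕ}
    (hα : α ∈ Finset.Nat.antidiagonalTuple n k) (m : Fin n → ℤ) :
    ((directions α).map fun j => 2 * Real.pi * m j).prod =
      (2 * Real.pi) ^ k * ∏ i, (m i : ℝ) ^ α i := by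
  rw [prod_map_directions]
  simp only [mul_pow _ (Int.cast _)]
  rw [Finset.prod_mul_distrib, Finset.prod_pow_eq_pow_sum,
    Finset.Nat.mem_antidiagonalTuple.mp hα]

lemma fourierMap_clm_comp {E F : Type*} [NormedAddCommGroup E] [NormedSpace ℝ E]
    [NormedAddCommGroup F] [NormedSpace ℝ F] [CompleteSpace E] [CompleteSpace F]
    (T : E →L[ℝ] F) {w : (Fin n → ℝ) → E} (hw : Continuous w) (m : Fin n → ℤ) (z : ℂ) :
    fourierMap (fun x => T (w x)) m z = T (fourierMap w m z) := by
  have hc : Continuous fun x => wavePairing m x z • w x :=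
    ((continuous_wavePairing m).clm_apply continuous_const).smul hw
  have hT : Continuous fun x => T (w x) := T.continuous.comp hw
  rw [fourierMap_apply hT, fourierMap_apply hw, ← T.integral_comp_comm (integrableOn_cube hc)]
  simp

lemma fourierMap_diffOp [FiniteDimensional ℝ W] [FiniteDimensional ℝ X] {k : ℕ}
    (A : (Fin n → ℕ) → (W →ₗ[ℝ] X)) {w : (Fin n → ℝ) → W} (hw : ContDiff ℝ (⊤ : ℕ∞) w)
    (hp : LatticePeriodic w) (m : Fin n → ℤ) (z : ℂ) :
    fourierMap (diffOp k A w) m z = (2 * Real.pi) ^ k •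
      symbolOf k A (fun i => (m i : ℝ)) (fourierMap w m (Complex.I ^ k * z)) := by
  have : CompleteSpace W := FiniteDimensional.complete ℝ W
  have : CompleteSpace X := FiniteDimensional.complete ℝ X
  have hc : ∀ z, Continuous fun x => wavePairing m x z := fun z =>
    (continuous_wavePairing m).clm_apply continuous_const
  have hcA : ∀ α, Continuous fun x => (LinearMap.toContinuousLinearMap (A α))
      ((directions α).foldr pderivI w x) := fun α =>
    (LinearMap.toContinuousLinearMap (A α)).continuous.comp
      (contDiff_foldr_pderivI hw _).continuous
  rw [fourierMap_apply (contDiff_diffOp A hw).continuous]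
  have hsum : ∀ x, wavePairing m x z • diffOp k A w x =
      ∑ α ∈ Finset.Nat.antidiagonalTuple n k, wavePairing m x z •
        (LinearMap.toContinuousLinearMap (A α)) ((directions α).foldr pderivI w x) := fun x => by
    rw [diffOp_apply, Finset.smul_sum]
    rfl
  simp only [hsum]
  have hi : ∀ α ∈ Finset.Nat.antidiagonalTuple n k, IntegrableOn (fun x => wavePairing m x z •
      (LinearMap.toContinuousLinearMap (A α)) ((directions α).foldr pderivI w x))
      (Set.Icc (0 : Fin n → ℝ) 1) := fun α _ => integrableOn_cube ((hc z).smul (hcA α))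
  rw [integral_finsetSum _ hi]
  simp only [symbolOf, LinearMap.sum_apply, LinearMap.smul_apply, Finset.smul_sum]
  refine Finset.sum_congr rfl fun α hα => ?_
  rw [← fourierMap_apply (hcA α), fourierMap_clm_comp _
    (contDiff_foldr_pderivI hw _).continuous, fourierMap_foldr_pderivI hw hp,
    length_directions_of_mem hα, prod_map_two_pi_mul hα]
  simp [smul_smul]

/-- A family of coefficients over the integer lattice decaying faster than any power. -/
def RapidDecay (c : (Fin n → ℤ) → ℂ →L[ℝ] W) : Prop :=
  ∀ N : ℕ, ∃ C : ℝ, ∀ m, ‖m‖ ^ N * ‖c m‖ ≤ C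

lemma RapidDecay.of_le {c : (Fin n → ℤ) → ℂ →L[ℝ] W} (hc : RapidDecay c)
    {c' : (Fin n → ℤ) → ℂ →L[ℝ] X} {K : ℝ} (hK : 0 ≤ K) (M : ℕ)
    (h : ∀ m, ‖c' m‖ ≤ K * (‖m‖ ^ M * ‖c m‖)) : RapidDecay c' := fun N => by
  obtain ⟨C, hC⟩ := hc (N + M)
  refine ⟨K * C, fun m => ?_⟩
  calc ‖m‖ ^ N * ‖c' m‖ ≤ ‖m‖ ^ N * (K * (‖m‖ ^ M * ‖c m‖)) := by gcongr; exact h m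
    _ = K * (‖m‖ ^ (N + M) * ‖c m‖) := by rw [pow_add]; ring
    _ ≤ K * C := by gcongr; exact hC m

lemma norm_intCast_pi (m : Fin n → ℤ) : ‖(fun i => (m i : ℝ))‖ = ‖m‖ := by
  simp only [Pi.norm_def]
  congr 2

lemma exists_summable_norm_inv_pow (n : ℕ) :
    ∃ M : ℕ, Summable fun m : Fin n → ℤ => ‖m‖⁻¹ ^ M := by
  let L := Submodule.span ℤ (Set.range (Pi.basisFun ℝ (Fin n)))
  have hmem : ∀ m : Fin n → ℤ, (fun i => (m i : ℝ)) ∈ L := fun m => by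
    refine ((Pi.basisFun ℝ (Fin n)).mem_span_iff_repr_mem ℤ _).mpr fun i => ?_
    exact ⟨m i, by simp⟩
  let ι : (Fin n → ℤ) → L := fun m => ⟨fun i => (m i : ℝ), hmem m⟩
  have hι : Function.Injective ι := fun a b h => by
    ext i
    exact Int.cast_injective (α := ℝ) (congrFun (congrArg Subtype.val h) i)
  refine ⟨Module.finrank ℤ L + 1, ?_⟩
  refine ((ZLattice.summable_norm_pow_inv L (Module.finrank ℤ L + 1)
    (Nat.lt_succ_self _)).comp_injective hι).congr fun m => ?_
  simp only [Function.comp, ι, Submodule.coe_norm, norm_intCast_pi]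

lemma RapidDecay.summable {c : (Fin n → ℤ) → ℂ →L[ℝ] W} (hc : RapidDecay c) (N : ℕ) :
    Summable fun m => ‖m‖ ^ N * ‖c m‖ := by
  obtain ⟨M, hM⟩ := exists_summable_norm_inv_pow n
  obtain ⟨C, hC⟩ := hc (N + M)
  refine Summable.of_norm_bounded_eventually (hM.mul_left C) ?_
  filter_upwards [(Set.finite_singleton (0 : Fin n → ℤ)).compl_mem_cofinite] with m hm
  have hm0 : 0 < ‖m‖ := norm_pos_iff.mpr hm
  rw [Real.norm_of_nonneg (by positivity), inv_pow, ← div_eq_mul_inv, le_div_iff₀ (by positivity)]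
  calc _ = ‖m‖ ^ (N + M) * ‖c m‖ := by rw [pow_add]; ring
    _ ≤ C := hC m

lemma rapidDecay_fourierMap {w : (Fin n → ℝ) → W} (hw : ContDiff ℝ (⊤ : ℕ∞) w)
    (hp : LatticePeriodic w) : RapidDecay (fourierMap w) := fun N => by
  have hcoord : ∀ j : Fin n, ∃ C : ℝ, ∀ m : Fin n → ℤ, ‖m j‖ ^ N * ‖fourierMap w m‖ ≤ C := by
    intro j
    set L := List.replicate N j with hL
    obtain ⟨C, hC0, hC⟩ :=
      (hp.foldr_pderivI L).exists_norm_le (contDiff_foldr_pderivI hw L).continuous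
    refine ⟨C, fun m => ?_⟩
    rw [← Int.norm_cast_real, ← norm_pow, ← norm_smul]
    refine ContinuousLinearMap.opNorm_le_bound _ hC0 fun z => ?_
    have h := fourierMap_foldr_pderivI hw hp L m ((Complex.I ^ N)⁻¹ * z)
    rw [hL, List.length_replicate, mul_inv_cancel_left₀ (pow_ne_zero _ Complex.I_ne_zero),
      List.map_replicate, List.prod_replicate, ← hL] at h
    have h2 := (ContinuousLinearMap.le_opNorm (fourierMap (L.foldr pderivI w) m)
      ((Complex.I ^ N)⁻¹ * z)).trans (mul_le_mul_of_nonneg_right (norm_fourierMap_le hC m)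
        (norm_nonneg _))
    rw [h, norm_mul, norm_inv, norm_pow, Complex.norm_I, one_pow, inv_one, one_mul] at h2
    refine le_trans ?_ h2
    rw [smul_apply, norm_smul, norm_smul, norm_pow, norm_pow]
    gcongr
    rw [norm_mul]
    refine le_mul_of_one_le_left (norm_nonneg _) ?_
    rw [Real.norm_of_nonneg (by positivity)]
    linarith [Real.pi_gt_three]
  choose C hC using hcoord
  obtain ⟨C₀, -, hC₀⟩ := hp.exists_norm_le hw.continuous
  rcases isEmpty_or_nonempty (Fin n) with hn | hn
  · refine ⟨C₀, fun m => ?_⟩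
    refine (mul_le_of_le_one_left (norm_nonneg _) ?_).trans (norm_fourierMap_le hC₀ m)
    rw [Subsingleton.elim m 0, norm_zero]
    exact pow_le_one₀ le_rfl zero_le_one
  · refine ⟨∑ j, |C j|, fun m => ?_⟩
    obtain ⟨j, hj⟩ := Finite.exists_max fun j => ‖m j‖
    calc ‖m‖ ^ N * ‖fourierMap w m‖ ≤ ‖m j‖ ^ N * ‖fourierMap w m‖ := by
          gcongr
          exact (pi_norm_le_iff_of_nonneg (norm_nonneg _)).mpr hj
      _ ≤ |C j| := (hC j m).trans (le_abs_self _)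
      _ ≤ _ := Finset.single_le_sum (f := fun j => |C j|) (fun _ _ => abs_nonneg _)
          (Finset.mem_univ j)

end FourierSeries

section TrigSeries

variable {n : ℕ} {V W X : Type*}
  [NormedAddCommGroup V] [NormedSpace ℝ V]
  [NormedAddCommGroup W] [NormedSpace ℝ W]
  [NormedAddCommGroup X] [NormedSpace ℝ X]

/-- The trigonometric series with coefficients `c`. -/
noncomputable def trigSeries (c : (Fin n → ℤ) → ℂ →L[ℝ] W) (x : Fin n → ℝ) : W :=
  ∑' m, c m (wave m x)

lemma latticePeriodic_trigSeries (c : (Fin n → ℤ) → ℂ →L[ℝ] W) :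
    LatticePeriodic (trigSeries c) := fun x z =>
  tsum_congr fun m => by rw [latticePeriodic_wave m x z]

lemma norm_apply_wave_le (T : ℂ →L[ℝ] W) (m : Fin n → ℤ) (x : Fin n → ℝ) :
    ‖T (wave m x)‖ ≤ ‖T‖ := by
  simpa [norm_wave] using T.le_opNorm (wave m x)

lemma RapidDecay.summable_norm {c : (Fin n → ℤ) → ℂ →L[ℝ] W} (hc : RapidDecay c) :
    Summable fun m => ‖c m‖ := by
  simpa using hc.summable 0

lemma RapidDecay.summable_apply_wave [CompleteSpace W] {c : (Fin n → ℤ) → ℂ →L[ℝ] W}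
    (hc : RapidDecay c) (x : Fin n → ℝ) : Summable fun m => c m (wave m x) :=
  Summable.of_norm_bounded hc.summable_norm fun _ => norm_apply_wave_le _ _ _

lemma norm_phase_le (m : Fin n → ℤ) : ‖phase m‖ ≤ 2 * Real.pi * n * ‖m‖ := by
  refine ContinuousLinearMap.opNorm_le_bound _ (by positivity) fun x => ?_
  rw [phase_apply]
  refine (norm_sum_le _ _).trans ?_
  refine (Finset.sum_le_card_nsmul _ _ (2 * Real.pi * ‖m‖ * ‖x‖) fun j _ => ?_).trans_eq ?_
  · rw [norm_mul, norm_mul, Real.norm_of_nonneg (by positivity : (0 : ℝ) ≤ 2 * Real.pi),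
      Int.norm_cast_real]
    gcongr
    · exact norm_le_pi_norm m j
    · exact norm_le_pi_norm x j
  · simp
    ring

/-- The coefficients of the derivative of a trigonometric series in direction `y`. -/
noncomputable def dirCoeff (y : Fin n → ℝ) (c : (Fin n → ℤ) → ℂ →L[ℝ] W) (m : Fin n → ℤ) :
    ℂ →L[ℝ] W :=
  phase m y • (c m ∘L mulC Complex.I)

lemma RapidDecay.dirCoeff {c : (Fin n → ℤ) → ℂ →L[ℝ] W} (hc : RapidDecay c) (y : Fin n → ℝ) :
    RapidDecay (dirCoeff y c) := by
  refine hc.of_le (K := 2 * Real.pi * n * ‖y‖) (by positivity) 1 fun m => ?_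
  have h1 : ‖c m ∘L mulC Complex.I‖ ≤ ‖c m‖ := by
    refine (ContinuousLinearMap.opNorm_comp_le _ _).trans
      (mul_le_of_le_one_right (norm_nonneg _) ?_)
    simpa using norm_mulC_le Complex.I
  have h2 : ‖phase m y‖ ≤ 2 * Real.pi * n * ‖m‖ * ‖y‖ :=
    ((phase m).le_opNorm y).trans (by gcongr; exact norm_phase_le m)
  rw [PeriodicDiffOp.dirCoeff, norm_smul, pow_one]
  calc _ ≤ (2 * Real.pi * n * ‖m‖ * ‖y‖) * ‖c m‖ := by gcongr
    _ = _ := by ring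

lemma RapidDecay.hasFDerivAt_trigSeries [CompleteSpace W] {c : (Fin n → ℤ) → ℂ →L[ℝ] W}
    (hc : RapidDecay c) (x : Fin n → ℝ) :
    HasFDerivAt (trigSeries c)
      (∑' m, c m ∘L (phase m).smulRight (Complex.I * wave m x)) x ∧
    Summable fun m => c m ∘L (phase m).smulRight (Complex.I * wave m x) := by
  have hu : Summable fun m => 2 * Real.pi * n * (‖m‖ ^ 1 * ‖c m‖) := (hc.summable 1).mul_left _
  have hb : ∀ (m : Fin n → ℤ) (x : Fin n → ℝ),
      ‖c m ∘L (phase m).smulRight (Complex.I * wave m x)‖ ≤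
        2 * Real.pi * n * (‖m‖ ^ 1 * ‖c m‖) := fun m x => by
    refine (ContinuousLinearMap.opNorm_comp_le _ _).trans ?_
    rw [ContinuousLinearMap.norm_smulRight_apply, norm_mul, norm_wave, Complex.norm_I, one_mul,
      mul_one, pow_one]
    calc _ ≤ ‖c m‖ * (2 * Real.pi * n * ‖m‖) := by gcongr; exact norm_phase_le m
      _ = _ := by ring
  exact ⟨hasFDerivAt_tsum hu (fun m x => (c m).hasFDerivAt.comp x (hasFDerivAt_wave m x)) hb
    (hc.summable_apply_wave x) x, Summable.of_norm_bounded hu fun m => hb m x⟩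

lemma RapidDecay.fderiv_trigSeries [CompleteSpace W] {c : (Fin n → ℤ) → ℂ →L[ℝ] W}
    (hc : RapidDecay c) (x y : Fin n → ℝ) :
    fderiv ℝ (trigSeries c) x y = trigSeries (PeriodicDiffOp.dirCoeff y c) x := by
  obtain ⟨h, hs⟩ := hc.hasFDerivAt_trigSeries x
  rw [h.fderiv]
  refine ((ContinuousLinearMap.apply ℝ W y).map_tsum hs).trans (tsum_congr fun m => ?_)
  simp [PeriodicDiffOp.dirCoeff, -Complex.real_smul]

lemma RapidDecay.contDiff_trigSeries [CompleteSpace W] {c : (Fin n → ℤ) → ℂ →L[ℝ] W}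
    (hc : RapidDecay c) : ContDiff ℝ (⊤ : ℕ∞) (trigSeries c) := by
  have hd : ∀ {c : (Fin n → ℤ) → ℂ →L[ℝ] W}, RapidDecay c → Differentiable ℝ (trigSeries c) :=
    fun hc x => (hc.hasFDerivAt_trigSeries x).1.differentiableAt
  refine contDiff_infty.mpr fun N => ?_
  induction N generalizing c with
  | zero => exact contDiff_zero.mpr (hd hc).continuous
  | succ N ih =>
    rw [Nat.cast_succ]
    refine contDiff_succ_iff_fderiv_apply.mpr ⟨hd hc, fun h => absurd h (by simp), fun y => ?_⟩
    simp only [hc.fderiv_trigSeries]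
    exact ih (hc.dirCoeff y)

lemma RapidDecay.pderivI_trigSeries [CompleteSpace W] {c : (Fin n → ℤ) → ℂ →L[ℝ] W}
    (hc : RapidDecay c) (j : Fin n) :
    pderivI j (trigSeries c) = trigSeries (PeriodicDiffOp.dirCoeff (Pi.single j 1) c) :=
  funext fun x => hc.fderiv_trigSeries x _

lemma RapidDecay.foldr_pderivI_trigSeries [CompleteSpace W] {c : (Fin n → ℤ) → ℂ →L[ℝ] W}
    (hc : RapidDecay c) (L : List (Fin n)) :
    ∃ c' : (Fin n → ℤ) → ℂ →L[ℝ] W, RapidDecay c' ∧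
      L.foldr pderivI (trigSeries c) = trigSeries c' ∧
      ∀ m z, c' m z = (L.map fun j => 2 * Real.pi * m j).prod • c m (Complex.I ^ L.length * z) := by
  induction L with
  | nil => exact ⟨c, hc, rfl, by simp⟩
  | cons j L ih =>
    obtain ⟨c', hc', h, h'⟩ := ih
    refine ⟨_, hc'.dirCoeff (Pi.single j 1), ?_, fun m z => ?_⟩
    · rw [List.foldr_cons, h, hc'.pderivI_trigSeries]
    · simp [PeriodicDiffOp.dirCoeff, h', phase_single, smul_smul, pow_succ, mul_assoc]

lemma RapidDecay.diffOp_trigSeries [CompleteSpace W] [FiniteDimensional ℝ W] {k : ℕ}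
    {c : (Fin n → ℤ) → ℂ →L[ℝ] W} (hc : RapidDecay c) (A : (Fin n → ℕ) → (W →ₗ[ℝ] X))
    (x : Fin n → ℝ) :
    diffOp k A (trigSeries c) x = ∑' m, (2 * Real.pi) ^ k •
      symbolOf k A (fun i => (m i : ℝ)) (c m (Complex.I ^ k * wave m x)) := by
  choose c' hc' h h' using hc.foldr_pderivI_trigSeries
  rw [diffOp_apply]
  have hA : ∀ α, Summable fun m => LinearMap.toContinuousLinearMap (A α)
      (c' (directions α) m (wave m x)) := fun α =>
    ((hc' _).summable_apply_wave x).map (LinearMap.toContinuousLinearMap (A α))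
      (LinearMap.toContinuousLinearMap (A α)).continuous
  have : ∀ α, A α ((directions α).foldr pderivI (trigSeries c) x) = 
      ∑' m, LinearMap.toContinuousLinearMap (A α) (c' (directions α) m (wave m x)) := fun α => by
    rw [h]
    exact (LinearMap.toContinuousLinearMap (A α)).map_tsum ((hc' _).summable_apply_wave x)
  simp only [this]
  rw [← Summable.tsum_finsetSum fun α _ => hA α]
  refine tsum_congr fun m => ?_
  simp only [symbolOf, LinearMap.sum_apply, LinearMap.smul_apply, Finset.smul_sum]
  refine Finset.sum_congr rfl fun α hα => ?_
  rw [h', length_directions_of_mem hα, prod_map_two_pi_mul hα]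
  simp [smul_smul]

end TrigSeries

section Inversion

variable {n : ℕ} {V W X : Type*}
  [NormedAddCommGroup V] [NormedSpace ℝ V]
  [NormedAddCommGroup W] [NormedSpace ℝ W]
  [NormedAddCommGroup X] [NormedSpace ℝ X]

/-- The quotient map onto the standard torus. -/
def toTorus (x : Fin n → ℝ) : UnitAddTorus (Fin n) := fun i => (x i : UnitAddCircle)

lemma isOpenQuotientMap_toTorus : IsOpenQuotientMap (toTorus (n := n)) :=
  IsOpenQuotientMap.piMap fun _ => QuotientAddGroup.isOpenQuotientMap_mk

lemma toTorus_eq_iff {x y : Fin n → ℝ} :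
    toTorus x = toTorus y ↔ ∃ z : Fin n → ℤ, x + (fun i => (z i : ℝ)) = y := by
  constructor
  · intro h
    have : ∀ i, ∃ z : ℤ, (z : ℝ) = y i - x i := fun i => by
      have hi : ((y i - x i : ℝ) : UnitAddCircle) = 0 := by
        rw [AddCircle.coe_sub, sub_eq_zero]
        exact (congrFun h i).symm
      obtain ⟨z, hz⟩ := (AddCircle.coe_eq_zero_iff 1).mp hi
      exact ⟨z, by simpa using hz⟩
    choose z hz using this
    exact ⟨z, funext fun i => by simp [hz]⟩
  · rintro ⟨z, rfl⟩
    ext i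
    simp [toTorus]

lemma LatticePeriodic.exists_toTorus_lift {E : Type*} {g : (Fin n → ℝ) → E}
    (hp : LatticePeriodic g) :
    ∃ G : UnitAddTorus (Fin n) → E, ∀ x, G (toTorus x) = g x := by
  refine ⟨fun t => g (Function.surjInv isOpenQuotientMap_toTorus.surjective t), fun x => ?_⟩
  obtain ⟨z, hz⟩ := toTorus_eq_iff.mp
    (Function.surjInv_eq isOpenQuotientMap_toTorus.surjective (toTorus x))
  exact (hp _ z).symm.trans (congrArg g hz)

lemma cube_ae_eq : {x : Fin n → ℝ | ∀ i, x i ∈ Set.Ioc ((0 : Fin n → ℝ) i) ((0 : Fin n → ℝ) i + 1)}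
    =ᵐ[volume] Set.Icc (0 : Fin n → ℝ) 1 := by
  have := Measure.univ_pi_Ioc_ae_eq_Icc (μ := fun _ : Fin n => (volume : Measure ℝ))
    (f := (0 : Fin n → ℝ)) (g := 1)
  have h : {x : Fin n → ℝ | ∀ i, x i ∈ Set.Ioc ((0 : Fin n → ℝ) i) ((0 : Fin n → ℝ) i + 1)} =
      Set.univ.pi fun i => Set.Ioc ((0 : Fin n → ℝ) i) ((1 : Fin n → ℝ) i) := by
    ext x
    simp
  rw [h]
  exact this

lemma LatticePeriodic.hasSum_wave {g : (Fin n → ℝ) → ℝ} (hp : LatticePeriodic g)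
    (hc : Continuous g)
    (hs : Summable fun m => ∫ y in Set.Icc (0 : Fin n → ℝ) 1,
      (starRingEnd ℂ) (wave m y) * (g y : ℂ))
    (x : Fin n → ℝ) :
    HasSum (fun m => (∫ y in Set.Icc (0 : Fin n → ℝ) 1, (starRingEnd ℂ) (wave m y) * (g y : ℂ)) *
      wave m x) (g x : ℂ) := by
  obtain ⟨G, hG⟩ := hp.exists_toTorus_lift
  have hGc : Continuous G := by
    rw [isOpenQuotientMap_toTorus.isQuotientMap.continuous_iff]
    exact hc.congr fun x => (hG x).symm
  let F : C(UnitAddTorus (Fin n), ℂ) := ⟨fun t => (G t : ℂ), Complex.continuous_ofReal.comp hGc⟩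
  have hF : ∀ m, UnitAddTorus.mFourierCoeff F m =
      ∫ y in Set.Icc (0 : Fin n → ℝ) 1, (starRingEnd ℂ) (wave m y) * (g y : ℂ) := fun m => by
    rw [UnitAddTorus.mFourierCoeff_eq_integral _ _ 0, setIntegral_congr_set cube_ae_eq]
    refine integral_congr_ae (Filter.Eventually.of_forall fun y => ?_)
    simp only [UnitAddTorus.mFourier_neg, mFourier_eq_wave, smul_eq_mul]
    congr 2
    exact congrArg Complex.ofReal (hG y)
  have h := UnitAddTorus.hasSum_mFourier_series_apply_of_summable (f := F)
    (hs.congr fun m => (hF m).symm)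
    (toTorus x)
  simp only [hF, smul_eq_mul] at h
  convert! h using 2 with m
  · congr 1
    exact (mFourier_eq_wave m x).symm
  · exact congrArg Complex.ofReal (hG x).symm

lemma trigSeries_fourierMap [CompleteSpace W] {w : (Fin n → ℝ) → W} (hw : ContDiff ℝ (⊤ : ℕ∞) w)
    (hp : LatticePeriodic w) : trigSeries (fourierMap w) = w := by
  have hr := rapidDecay_fourierMap hw hp
  ext x
  refine (SeparatingDual.eq_iff_forall_dual_eq (R := ℝ)).mpr fun ψ => ?_
  have hg : Continuous fun y => ψ (w y) := ψ.continuous.comp hw.continuous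
  have hgp : LatticePeriodic fun y => ψ (w y) := fun y z => by simp only [hp y z]
  have hint : ∀ m, IntegrableOn (fun y => (starRingEnd ℂ) (wave m y) * ((ψ (w y) : ℝ) : ℂ))
      (Set.Icc (0 : Fin n → ℝ) 1) := fun m => integrableOn_cube
    ((Complex.continuous_conj.comp (contDiff_wave m).continuous).mul
      (Complex.continuous_ofReal.comp hg))
  set F : (Fin n → ℤ) → ℂ := fun m =>
    ∫ y in Set.Icc (0 : Fin n → ℝ) 1, (starRingEnd ℂ) (wave m y) * ((ψ (w y) : ℝ) : ℂ) with hF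
  have hre : ∀ m z, ψ (fourierMap w m z) = (F m * z).re := fun m z => by
    have hi : IntegrableOn (fun y => wavePairing m y z • w y) (Set.Icc (0 : Fin n → ℝ) 1) :=
      integrableOn_cube (((continuous_wavePairing m).clm_apply continuous_const).smul
        hw.continuous)
    rw [fourierMap_apply hw.continuous, ← ContinuousLinearMap.integral_comp_comm ψ hi, hF]
    simp only
    rw [← integral_mul_const]
    refine Eq.trans ?_ (ContinuousLinearMap.integral_comp_comm Complex.reCLM
      ((hint m).mul_const z))
    refine integral_congr_ae (Filter.Eventually.of_forall fun y => ?_)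
    simp only [map_smul, smul_eq_mul, wavePairing_apply, Complex.reCLM_apply]
    rw [mul_right_comm, Complex.re_mul_ofReal]
  have hs : Summable F := by
    refine Summable.of_norm_bounded (hr.summable_norm.mul_left ‖ψ‖) fun m => ?_
    by_cases h0 : F m = 0
    · rw [h0, norm_zero]; positivity
    have h1 := hre m ((starRingEnd ℂ) (F m))
    rw [Complex.mul_conj, Complex.ofReal_re, Complex.normSq_eq_norm_sq] at h1
    have h2 : ‖F m‖ ^ 2 ≤ ‖ψ‖ * ‖fourierMap w m‖ * ‖F m‖ := by
      rw [← h1]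
      refine (le_abs_self _).trans ((ψ.le_opNorm _).trans ?_)
      rw [mul_assoc]
      gcongr
      simpa using (fourierMap w m).le_opNorm ((starRingEnd ℂ) (F m))
    rw [sq] at h2
    exact le_of_mul_le_mul_right h2 (norm_pos_iff.mpr h0)
  have h := Complex.hasSum_re (hgp.hasSum_wave hg hs x)
  simp only [Complex.ofReal_re] at h
  rw [trigSeries, ψ.map_tsum (hr.summable_apply_wave x)]
  simp only [hre]
  exact h.tsum_eq

lemma LatticePeriodic.eq_zero_of_fourierMap [CompleteSpace W] {w : (Fin n → ℝ) → W}
    (hp : LatticePeriodic w) (hw : ContDiff ℝ (⊤ : ℕ∞) w) (h : ∀ m, fourierMap w m = 0)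
    (x : Fin n → ℝ) : w x = 0 := by
  rw [← trigSeries_fourierMap hw hp]
  simp [trigSeries, h]

end Inversion

section Solve

variable {n : ℕ} {V W X : Type*}
  [NormedAddCommGroup V] [NormedSpace ℝ V]
  [NormedAddCommGroup W] [NormedSpace ℝ W]
  [NormedAddCommGroup X] [NormedSpace ℝ X]

lemma symbolOf_apply {k : ℕ} (A : (Fin n → ℕ) → (W →ₗ[ℝ] X)) (ξ : Fin n → ℝ) (v : W) :
    symbolOf k A ξ v = ∑ α ∈ Finset.Nat.antidiagonalTuple n k, (∏ i, ξ i ^ α i) • A α v := by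
  simp [symbolOf, LinearMap.sum_apply]

lemma symbolOf_smul {k : ℕ} (A : (Fin n → ℕ) → (W →ₗ[ℝ] X)) (t : ℝ) (ξ : Fin n → ℝ) :
    symbolOf k A (t • ξ) = t ^ k • symbolOf k A ξ := by
  rw [symbolOf, symbolOf, Finset.smul_sum]
  refine Finset.sum_congr rfl fun α hα => ?_
  rw [smul_smul]
  congr 1
  simp only [Pi.smul_apply, smul_eq_mul, mul_pow, Finset.prod_mul_distrib,
    Finset.prod_pow_eq_pow_sum, Finset.Nat.mem_antidiagonalTuple.mp hα]

lemma symbolOf_zero {k : ℕ} (hk : 1 ≤ k) (A : (Fin n → ℕ) → (W →ₗ[ℝ] X)) :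
    symbolOf k A 0 = 0 := by
  have := symbolOf_smul (k := k) A 0 0
  rwa [zero_smul, zero_pow (by omega), zero_smul] at this

/-- If a continuous family of linear maps has locally constant rank, then elements of the range
locally have preimages of controlled norm. -/
lemma exists_bounded_preimage_near [FiniteDimensional ℝ V] [FiniteDimensional ℝ W]
    {Y : Type*} [TopologicalSpace Y] {S : Y → V →L[ℝ] W} {ξ₀ : Y}
    (hS : ContinuousAt S ξ₀)
    (hr : ∀ᶠ ξ in nhds ξ₀, Module.finrank ℝ (LinearMap.range (S ξ : V →ₗ[ℝ] W)) =
      Module.finrank ℝ (LinearMap.range (S ξ₀ : V →ₗ[ℝ] W))) :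
    ∃ C : ℝ, ∀ᶠ ξ in nhds ξ₀, ∀ v, ∃ v', S ξ v' = S ξ v ∧ ‖v'‖ ≤ C * ‖S ξ v‖ := by
  obtain ⟨K, hK⟩ := Submodule.exists_isCompl (LinearMap.ker (S ξ₀ : V →ₗ[ℝ] W))
  have hker : LinearMap.ker ((S ξ₀ : V →ₗ[ℝ] W).domRestrict K) = ⊥ := by
    rw [LinearMap.ker_eq_bot, LinearMap.injective_domRestrict_iff]
    exact hK.symm.disjoint
  obtain ⟨κ, hκ, hanti⟩ := LinearMap.exists_antilipschitzWith _ hker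
  have hlow : ∀ v ∈ K, ‖v‖ ≤ κ * ‖S ξ₀ v‖ := fun v hv => by
    have := hanti.le_mul_dist ⟨v, hv⟩ 0
    simpa using this
  have hdimK : Module.finrank ℝ K = Module.finrank ℝ (LinearMap.range (S ξ₀ : V →ₗ[ℝ] W)) := by
    have h1 := Submodule.finrank_add_eq_of_isCompl hK
    have h2 := LinearMap.finrank_range_add_finrank_ker (S ξ₀ : V →ₗ[ℝ] W)
    omega
  refine ⟨2 * κ, ?_⟩
  have hκ' : (0 : ℝ) < κ := hκ
  have hclose : ∀ᶠ ξ in nhds ξ₀, ‖S ξ - S ξ₀‖ < (2 * κ : ℝ)⁻¹ := by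
    have := Metric.tendsto_nhds.mp hS _ (show (0 : ℝ) < (2 * κ : ℝ)⁻¹ by positivity)
    simpa only [dist_eq_norm] using this
  filter_upwards [hr, hclose] with ξ hξ hd
  have hlow' : ∀ v ∈ K, ‖v‖ ≤ 2 * κ * ‖S ξ v‖ := fun v hv => by
    have h1 : ‖S ξ₀ v‖ ≤ ‖S ξ v‖ + (2 * κ : ℝ)⁻¹ * ‖v‖ := by
      calc ‖S ξ₀ v‖ = ‖S ξ v - (S ξ - S ξ₀) v‖ := by simp
        _ ≤ ‖S ξ v‖ + ‖(S ξ - S ξ₀) v‖ := norm_sub_le _ _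
        _ ≤ _ := by
          gcongr
          exact ((S ξ - S ξ₀).le_opNorm v).trans (by gcongr)
    have h2 := (hlow v hv).trans (mul_le_mul_of_nonneg_left h1 hκ'.le)
    have h3 : (κ : ℝ) * ((2 * κ : ℝ)⁻¹ * ‖v‖) = ‖v‖ / 2 := by field_simp
    rw [mul_add, h3] at h2
    linarith
  have hinj : Function.Injective ((S ξ : V →ₗ[ℝ] W).domRestrict K) := by
    rw [← LinearMap.ker_eq_bot, LinearMap.ker_eq_bot']
    rintro ⟨v, hv⟩ h
    have h' : S ξ v = 0 := h
    have := hlow' v hv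
    rw [h', norm_zero, mul_zero] at this
    exact Subtype.ext (norm_le_zero_iff.mp this)
  have hrange : LinearMap.range ((S ξ : V →ₗ[ℝ] W).domRestrict K) =
      LinearMap.range (S ξ : V →ₗ[ℝ] W) := by
    refine Submodule.eq_of_le_of_finrank_eq ?_ ?_
    · rintro _ ⟨v, rfl⟩
      exact ⟨v, rfl⟩
    · rw [LinearMap.finrank_range_of_inj hinj, hξ, hdimK]
  intro v
  have hv : S ξ v ∈ LinearMap.range ((S ξ : V →ₗ[ℝ] W).domRestrict K) := by
    rw [hrange]
    exact ⟨v, rfl⟩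
  obtain ⟨⟨v', hv'⟩, h⟩ := hv
  have h' : S ξ v' = S ξ v := h
  exact ⟨v', h', h' ▸ hlow' v' hv'⟩

lemma exists_bounded_preimage_symbolOf [FiniteDimensional ℝ V] [FiniteDimensional ℝ W] {l : ℕ}
    (B : (Fin n → ℕ) → (V →ₗ[ℝ] W))
    (hB : ∃ s : ℕ, ∀ ξ : Fin n → ℝ, ξ ≠ 0 →
      Module.finrank ℝ (LinearMap.range (symbolOf l B ξ)) = s) :
    ∃ C : ℝ, 0 ≤ C ∧ ∀ ξ : Fin n → ℝ, 1 ≤ ‖ξ‖ → ∀ v, ∃ v', symbolOf l B ξ v' = symbolOf l B ξ v ∧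
      ‖v'‖ ≤ C * ‖symbolOf l B ξ v‖ := by
  obtain ⟨s, hs⟩ := hB
  let S : (Fin n → ℝ) → V →L[ℝ] W := fun ξ => LinearMap.toContinuousLinearMap (symbolOf l B ξ)
  have hS : Continuous S := by
    have : S = fun ξ => ∑ α ∈ Finset.Nat.antidiagonalTuple n l,
        (∏ i, ξ i ^ α i) • LinearMap.toContinuousLinearMap (B α) := by
      ext ξ v
      simp [S, symbolOf_apply]
    rw [this]
    fun_prop
  have hsph : ∃ C : ℝ, ∀ ξ ∈ Metric.sphere (0 : Fin n → ℝ) 1,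
      ∀ v, ∃ v', S ξ v' = S ξ v ∧ ‖v'‖ ≤ C * ‖S ξ v‖ := by
    refine (isCompact_sphere (0 : Fin n → ℝ) 1).induction_on
      (p := fun t => ∃ C : ℝ, ∀ ξ ∈ t, ∀ v, ∃ v', S ξ v' = S ξ v ∧ ‖v'‖ ≤ C * ‖S ξ v‖)
      ⟨0, by simp⟩ (fun s t hst ⟨C, hC⟩ => ⟨C, fun ξ hξ => hC ξ (hst hξ)⟩) ?_ ?_
    · rintro t₁ t₂ ⟨C₁, h₁⟩ ⟨C₂, h₂⟩
      refine ⟨max C₁ C₂, fun ξ hξ v => ?_⟩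
      rcases hξ with hξ | hξ
      · obtain ⟨v', h, h'⟩ := h₁ ξ hξ v
        exact ⟨v', h, h'.trans (by gcongr; exact le_max_left _ _)⟩
      · obtain ⟨v', h, h'⟩ := h₂ ξ hξ v
        exact ⟨v', h, h'.trans (by gcongr; exact le_max_right _ _)⟩
    · intro ξ₀ hξ₀
      have h0 : ξ₀ ≠ 0 := ne_zero_of_mem_unit_sphere ⟨ξ₀, hξ₀⟩
      obtain ⟨C, hC⟩ := exists_bounded_preimage_near (hS.continuousAt (x := ξ₀)) (by
        filter_upwards [isOpen_ne.mem_nhds h0] with ξ hξ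
        exact (hs ξ hξ).trans (hs ξ₀ h0).symm)
      exact ⟨_, mem_nhdsWithin_of_mem_nhds hC, C, fun ξ hξ => hξ⟩
  obtain ⟨C, hC⟩ := hsph
  refine ⟨|C|, abs_nonneg C, fun ξ hξ v => ?_⟩
  have ht : 0 < ‖ξ‖ := by linarith
  have hξ' : ξ = ‖ξ‖ • (‖ξ‖⁻¹ • ξ) := by rw [smul_smul, mul_inv_cancel₀ ht.ne', one_smul]
  have hfac : symbolOf l B ξ = ‖ξ‖ ^ l • symbolOf l B (‖ξ‖⁻¹ • ξ) := by
    conv_lhs => rw [hξ', symbolOf_smul]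
  obtain ⟨v', h, h'⟩ := hC (‖ξ‖⁻¹ • ξ) (by
    rw [mem_sphere_zero_iff_norm, norm_smul, norm_inv, norm_norm, inv_mul_cancel₀ ht.ne'])
    (‖ξ‖ ^ l • v)
  have hv : S (‖ξ‖⁻¹ • ξ) (‖ξ‖ ^ l • v) = symbolOf l B ξ v := by
    rw [hfac, map_smul]
    rfl
  rw [hv] at h h'
  refine ⟨(‖ξ‖ ^ l)⁻¹ • v', ?_, ?_⟩
  · rw [← h, hfac, LinearMap.smul_apply, map_smul, smul_smul,
      mul_inv_cancel₀ (pow_pos ht l).ne', one_smul]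
    rfl
  · rw [norm_smul, norm_inv, norm_pow, norm_norm]
    refine (mul_le_of_le_one_left (norm_nonneg _) (inv_le_one_of_one_le₀ (one_le_pow₀ hξ))).trans ?_
    exact h'.trans (by gcongr; exact le_abs_self C)

lemma fourierMap_zero_apply {w : (Fin n → ℝ) → W} (hw : Continuous w) (z : ℂ) :
    fourierMap w 0 z = z.re • ∫ x in Set.Icc (0 : Fin n → ℝ) 1, w x := by
  rw [fourierMap_apply hw, ← integral_smul]
  simp [wavePairing_apply, wave, phase]

lemma one_le_norm_intCast {m : Fin n → ℤ} (hm : m ≠ 0) : 1 ≤ ‖(fun i => (m i : ℝ))‖ := by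
  obtain ⟨i, hi⟩ := Function.ne_iff.mp hm
  refine le_trans ?_ (norm_le_pi_norm _ i)
  rw [Int.norm_cast_real, Int.norm_eq_abs]
  exact_mod_cast Int.one_le_abs hi

lemma intCast_ne_zero {m : Fin n → ℤ} (hm : m ≠ 0) : (fun i => (m i : ℝ)) ≠ 0 :=
  norm_pos_iff.mp (one_pos.trans_le (one_le_norm_intCast hm))

/-- A smooth periodic field of mean zero annihilated by `A` is of the form `B u` with `u` smooth
and periodic. -/
lemma exists_diffOp_eq [FiniteDimensional ℝ V] [FiniteDimensional ℝ W] [FiniteDimensional ℝ X]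
    {k l : ℕ}
    (A : (Fin n → ℕ) → (W →ₗ[ℝ] X)) (B : (Fin n → ℕ) → (V →ₗ[ℝ] W))
    (hB : ∃ s : ℕ, ∀ ξ : Fin n → ℝ, ξ ≠ 0 →
      Module.finrank ℝ (LinearMap.range (symbolOf l B ξ)) = s)
    (hexact : ∀ ξ : Fin n → ℝ, ξ ≠ 0 →
      LinearMap.ker (symbolOf k A ξ) = LinearMap.range (symbolOf l B ξ))
    {w : (Fin n → ℝ) → W} (hw : ContDiff ℝ (⊤ : ℕ∞) w) (hp : LatticePeriodic w)
    (hAw : ∀ x, diffOp k A w x = 0) (hmean : ∫ x in Set.Icc (0 : Fin n → ℝ) 1, w x = 0) :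
    ∃ u : (Fin n → ℝ) → V, ContDiff ℝ (⊤ : ℕ∞) u ∧ LatticePeriodic u ∧
      ∀ x, diffOp l B u x = w x := by
  have := FiniteDimensional.complete ℝ V
  have := FiniteDimensional.complete ℝ W
  obtain ⟨C, hC0, hC⟩ := exists_bounded_preimage_symbolOf B hB
  have hmem : ∀ m : Fin n → ℤ, m ≠ 0 → ∀ z,
      fourierMap w m z ∈ LinearMap.range (symbolOf l B fun i => (m i : ℝ)) := fun m hm z => by
    rw [← hexact _ (intCast_ne_zero hm), LinearMap.mem_ker]
    have h := fourierMap_diffOp (k := k) A hw hp m ((Complex.I ^ k)⁻¹ * z)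
    rw [mul_inv_cancel_left₀ (pow_ne_zero _ Complex.I_ne_zero), funext hAw,
      fourierMap_apply continuous_const] at h
    simp only [smul_zero, integral_zero] at h
    exact (smul_eq_zero.mp h.symm).resolve_left (by positivity)
  have hpre : ∀ (m : Fin n → ℤ) (z : ℂ), ∃ v : V,
      symbolOf l B (fun i => (m i : ℝ)) v = fourierMap w m z ∧ ‖v‖ ≤ C * ‖fourierMap w m z‖ := by
    intro m z
    by_cases hm : m = 0
    · refine ⟨0, ?_, by rw [norm_zero]; positivity⟩
      rw [hm, fourierMap_zero_apply hw.continuous, hmean, smul_zero, map_zero]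
    · obtain ⟨v, hv⟩ := hmem m hm z
      obtain ⟨v', h, h'⟩ := hC _ (one_le_norm_intCast hm) v
      rw [hv] at h h'
      exact ⟨v', h, h'⟩
  choose v hv hvn using hpre
  let p : (Fin n → ℤ) → ℂ →L[ℝ] V := fun m =>
    Complex.reCLM.smulRight (v m 1) + Complex.imCLM.smulRight (v m Complex.I)
  have hp_symbol : ∀ m z, symbolOf l B (fun i => (m i : ℝ)) (p m z) = fourierMap w m z :=
    fun m z => by
    have hz : z = z.re • (1 : ℂ) + z.im • Complex.I := by
      simp [Complex.re_add_im]
    conv_rhs => rw [hz, map_add, map_smul, map_smul, ← hv, ← hv]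
    simp [p]
  have hp_norm : ∀ m, ‖p m‖ ≤ 2 * C * ‖fourierMap w m‖ := fun m => by
    refine ContinuousLinearMap.opNorm_le_bound _ (by positivity) fun z => ?_
    have hb : ∀ a : ℂ, ‖a‖ = 1 → ‖v m a‖ ≤ C * ‖fourierMap w m‖ := fun a ha =>
      (hvn m a).trans (by gcongr; simpa [ha] using (fourierMap w m).le_opNorm a)
    calc ‖p m z‖ = ‖z.re • v m 1 + z.im • v m Complex.I‖ := by simp [p]
      _ ≤ |z.re| * ‖v m 1‖ + |z.im| * ‖v m Complex.I‖ := by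
        refine (norm_add_le _ _).trans_eq ?_
        rw [norm_smul, norm_smul, Real.norm_eq_abs, Real.norm_eq_abs]
      _ ≤ ‖z‖ * (C * ‖fourierMap w m‖) + ‖z‖ * (C * ‖fourierMap w m‖) := by
        gcongr
        · exact Complex.abs_re_le_norm z
        · exact hb 1 norm_one
        · exact Complex.abs_im_le_norm z
        · exact hb _ Complex.norm_I
      _ = _ := by ring
  let c : (Fin n → ℤ) → ℂ →L[ℝ] V := fun m =>
    ((2 * Real.pi) ^ l)⁻¹ • (p m ∘L mulC (Complex.I ^ l)⁻¹)
  have hc : RapidDecay c := by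
    refine (rapidDecay_fourierMap hw hp).of_le (K := ((2 * Real.pi) ^ l)⁻¹ * (2 * C))
      (by positivity) 0 fun m => ?_
    have h1 : ‖p m ∘L mulC (Complex.I ^ l)⁻¹‖ ≤ ‖p m‖ := by
      refine (ContinuousLinearMap.opNorm_comp_le _ _).trans
        (mul_le_of_le_one_right (norm_nonneg _) ?_)
      simpa using norm_mulC_le (Complex.I ^ l)⁻¹
    rw [norm_smul, Real.norm_of_nonneg (by positivity), pow_zero, one_mul, mul_assoc]
    gcongr
    exact h1.trans (hp_norm m)
  refine ⟨trigSeries c, hc.contDiff_trigSeries, latticePeriodic_trigSeries c, fun x => ?_⟩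
  rw [hc.diffOp_trigSeries]
  conv_rhs => rw [← trigSeries_fourierMap hw hp]
  refine tsum_congr fun m => ?_
  rw [← hp_symbol]
  simp only [c, smul_apply, ContinuousLinearMap.comp_apply, mulC_apply, map_smul, smul_smul]
  rw [mul_inv_cancel₀ (by positivity), one_smul,
    inv_mul_cancel_left₀ (pow_ne_zero _ Complex.I_ne_zero)]

/-- If `A B` vanishes on the level of symbols, then `A (B u) = 0` for periodic `u`. -/
lemma diffOp_diffOp_eq_zero [FiniteDimensional ℝ V] [FiniteDimensional ℝ W] [FiniteDimensional ℝ X]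
    {k l : ℕ} (hl : 1 ≤ l)
    (A : (Fin n → ℕ) → (W →ₗ[ℝ] X)) (B : (Fin n → ℕ) → (V →ₗ[ℝ] W))
    (hexact : ∀ ξ : Fin n → ℝ, ξ ≠ 0 →
      LinearMap.ker (symbolOf k A ξ) = LinearMap.range (symbolOf l B ξ))
    {u : (Fin n → ℝ) → V} (hu : ContDiff ℝ (⊤ : ℕ∞) u) (hp : LatticePeriodic u) (x : Fin n → ℝ) :
    diffOp k A (diffOp l B u) x = 0 := by
  have := FiniteDimensional.complete ℝ X
  have hBu := contDiff_diffOp (k := l) B hu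
  have hBp := hp.diffOp (k := l) B
  refine (hBp.diffOp A).eq_zero_of_fourierMap (contDiff_diffOp A hBu) (fun m => ?_) x
  ext1 z
  rw [fourierMap_diffOp A hBu hBp, fourierMap_diffOp B hu hp, map_smul, zero_apply]
  have : symbolOf k A (fun i => (m i : ℝ)) (symbolOf l B (fun i => (m i : ℝ))
      (fourierMap u m (Complex.I ^ l * (Complex.I ^ k * z)))) = 0 := by
    by_cases hm : m = 0
    · have h0 : (fun i => ((0 : Fin n → ℤ) i : ℝ)) = 0 := by ext; simp
      rw [hm, h0, symbolOf_zero hl, LinearMap.zero_apply, map_zero]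
    · rw [← LinearMap.mem_ker, hexact _ (intCast_ne_zero hm)]
      exact ⟨_, rfl⟩
  rw [this, smul_zero, smul_zero]

lemma integral_diffOp_eq_zero [FiniteDimensional ℝ V] [FiniteDimensional ℝ W]
    {l : ℕ} (hl : 1 ≤ l) (B : (Fin n → ℕ) → (V →ₗ[ℝ] W))
    {u : (Fin n → ℝ) → V} (hu : ContDiff ℝ (⊤ : ℕ∞) u) (hp : LatticePeriodic u) :
    ∫ x in Set.Icc (0 : Fin n → ℝ) 1, diffOp l B u x = 0 := by
  have h := fourierMap_zero_apply (contDiff_diffOp (k := l) B hu).continuous 1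
  have h0 : (fun i => ((0 : Fin n → ℤ) i : ℝ)) = 0 := by ext; simp
  rw [fourierMap_diffOp B hu hp, h0, symbolOf_zero hl] at h
  simpa using h.symm

end Solve

section Periodization

variable {n : ℕ} {V W X : Type*}
  [NormedAddCommGroup V] [NormedSpace ℝ V]
  [NormedAddCommGroup W] [NormedSpace ℝ W]
  [NormedAddCommGroup X] [NormedSpace ℝ X]

lemma isOpen_openUnitCube : IsOpen (openUnitCube n) :=
  isOpen_set_pi Set.finite_univ fun _ _ => isOpen_Ioo

lemma openUnitCube_subset_Icc : openUnitCube n ⊆ Set.Icc 0 1 := fun _ hx =>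
  ⟨fun i => (hx i trivial).1.le, fun i => (hx i trivial).2.le⟩

lemma openUnitCube_ae_eq : openUnitCube n =ᵐ[volume] Set.Icc (0 : Fin n → ℝ) 1 :=
  Measure.univ_pi_Ioo_ae_eq_Icc (μ := fun _ : Fin n => (volume : Measure ℝ))
    (f := (0 : Fin n → ℝ)) (g := 1)

lemma fract_eq_of_mem_openUnitCube {x : Fin n → ℝ} (hx : x ∈ openUnitCube n) :
    (fun i => Int.fract (x i)) = x :=
  funext fun i => Int.fract_eq_self.mpr ⟨(hx i trivial).1.le, (hx i trivial).2⟩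

lemma toTorus_fract (x : Fin n → ℝ) : toTorus (fun i => Int.fract (x i)) = toTorus x :=
  toTorus_eq_iff.mpr ⟨fun i => ⌊x i⌋, funext fun i => by simp [Int.fract_add_floor]⟩

lemma fract_eq_of_toTorus_eq {x y : Fin n → ℝ} (h : toTorus x = toTorus y) :
    (fun i => Int.fract (x i)) = fun i => Int.fract (y i) := by
  obtain ⟨z, rfl⟩ := toTorus_eq_iff.mp h
  ext i
  simp

/-- A smooth function compactly supported in the open unit cube extends periodically. -/
lemma exists_periodic_extension {u : (Fin n → ℝ) → V} (hu : ContDiff ℝ (⊤ : ℕ∞) u)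
    (hs : tsupport u ⊆ openUnitCube n) :
    ∃ v : (Fin n → ℝ) → V, ContDiff ℝ (⊤ : ℕ∞) v ∧ LatticePeriodic v ∧
      ∀ x ∈ openUnitCube n, v x = u x := by
  refine ⟨fun x => u fun i => Int.fract (x i), ?_, fun x z => by simp, fun x hx => by
    simp only [fract_eq_of_mem_openUnitCube hx]⟩
  rw [contDiff_iff_contDiffAt]
  intro x
  by_cases hx : (fun i => Int.fract (x i)) ∈ openUnitCube n
  · have hsub : Continuous fun y : Fin n → ℝ => y - fun i => (⌊x i⌋ : ℝ) := by fun_prop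
    have hmem : ∀ᶠ y in nhds x, (y - fun i => (⌊x i⌋ : ℝ)) ∈ openUnitCube n :=
      hsub.continuousAt.eventually (isOpen_openUnitCube.mem_nhds (by
        simpa only [Int.self_sub_floor, Pi.sub_def] using hx))
    have hsm : ContDiffAt ℝ (⊤ : ℕ∞) (fun y => u (y - fun i => (⌊x i⌋ : ℝ))) x :=
      (hu.comp (contDiff_id.sub contDiff_const)).contDiffAt
    refine hsm.congr_of_eventuallyEq ?_
    filter_upwards [hmem] with y hy
    rw [← fract_eq_of_mem_openUnitCube hy]
    congr 1
    ext i
    simp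
  · have hK : IsCompact (tsupport u) := isCompact_Icc.of_isClosed_subset (isClosed_tsupport u)
      (hs.trans openUnitCube_subset_Icc)
    have hcont := (isOpenQuotientMap_toTorus (n := n)).continuous
    have hZ : IsClosed (toTorus ⁻¹' (toTorus '' tsupport u)) :=
      (hK.image hcont).isClosed.preimage hcont
    have hxZ : x ∉ toTorus ⁻¹' (toTorus '' tsupport u) := by
      rintro ⟨y, hy, hyx⟩
      refine hx ?_
      rw [← fract_eq_of_toTorus_eq hyx, fract_eq_of_mem_openUnitCube (hs hy)]
      exact hs hy
    refine (contDiffAt_const (c := (0 : V))).congr_of_eventuallyEq ?_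
    filter_upwards [hZ.isOpen_compl.mem_nhds hxZ] with y hy
    by_contra h0
    exact hy ⟨_, subset_tsupport u h0, toTorus_fract y⟩

lemma QAenv_le_QBenv [FiniteDimensional ℝ V] [FiniteDimensional ℝ W] [FiniteDimensional ℝ X]
    {k l : ℕ} (hl : 1 ≤ l)
    (A : (Fin n → ℕ) → (W →ₗ[ℝ] X)) (B : (Fin n → ℕ) → (V →ₗ[ℝ] W))
    (hexact : ∀ ξ : Fin n → ℝ, ξ ≠ 0 →
      LinearMap.ker (symbolOf k A ξ) = LinearMap.range (symbolOf l B ξ))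
    (f : W → ℝ) (η : W) : QAenv (k := k) A f η ≤ QBenv (l := l) B f η := by
  refine sInf_le_sInf ?_
  rintro y ⟨u, hu, hs, rfl⟩
  obtain ⟨v, hv, hp, hvu⟩ := exists_periodic_extension hu hs
  refine ⟨diffOp l B v, contDiff_diffOp B hv, hp.diffOp B,
    diffOp_diffOp_eq_zero hl A B hexact hv hp, integral_diffOp_eq_zero hl B hv hp, ?_⟩
  rw [← setIntegral_congr_set openUnitCube_ae_eq, ← setIntegral_congr_set openUnitCube_ae_eq]
  congr 1
  refine setIntegral_congr_fun isOpen_openUnitCube.measurableSet fun x hx => ?_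
  have : u =ᶠ[nhds x] v := by
    filter_upwards [isOpen_openUnitCube.mem_nhds hx] with y hy
    exact (hvu y hy).symm
  simp only [diffOp_congr B this]

/-- The integral of a periodic function over the unit cube is invariant under integer dilations. -/
lemma LatticePeriodic.integral_comp_smul {g : (Fin n → ℝ) → ℝ} (hp : LatticePeriodic g)
    (hg : Measurable g) {j : ℕ} (hj : j ≠ 0) :
    ∫ x in Set.Icc (0 : Fin n → ℝ) 1, g ((j : ℝ) • x) =
      ∫ x in Set.Icc (0 : Fin n → ℝ) 1, g x := by
  obtain ⟨G, hG⟩ := hp.exists_toTorus_lift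
  have hGm : Measurable G := by
    have hsec : ∀ t, toTorus (UnitAddTorus.measurableEquivPiIoc (0 : Fin n → ℝ) t).1 = t :=
      fun t => (UnitAddTorus.measurableEquivPiIoc (0 : Fin n → ℝ)).symm_apply_apply t
    have : G = fun t => g (UnitAddTorus.measurableEquivPiIoc (0 : Fin n → ℝ) t).1 :=
      funext fun t => by rw [← hG, hsec]
    rw [this]
    exact hg.comp (measurable_subtype_coe.comp (MeasurableEquiv.measurable _))
  have hint : ∀ F : UnitAddTorus (Fin n) → ℝ,
      ∫ t, F t ∂(Measure.pi fun _ : Fin n => AddCircle.haarAddCircle) =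
        ∫ x in Set.Icc (0 : Fin n → ℝ) 1, F (toTorus x) := fun F => by
    rw [← setIntegral_congr_set cube_ae_eq]
    exact UnitAddTorus.integral_preimage F 0
  have hmp := measurePreserving_pi
    (fun _ : Fin n => (AddCircle.haarAddCircle : Measure UnitAddCircle))
    (fun _ : Fin n => (AddCircle.haarAddCircle : Measure UnitAddCircle))
    (fun _ => Measure.measurePreserving_zsmul AddCircle.haarAddCircle (n := (j : ℤ))
      (by exact_mod_cast hj))
  have h1 := hint G
  rw [← hmp.map_eq, integral_map hmp.measurable.aemeasurable hGm.aestronglyMeasurable, hint] at h1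
  simp only [hG] at h1
  rw [← h1]
  congr 1
  ext x
  rw [← hG]
  congr 1
  ext i
  simp [toTorus]

end Periodization

section CutOff

variable {n : ℕ} {V W : Type*}
  [NormedAddCommGroup V] [NormedSpace ℝ V]
  [NormedAddCommGroup W] [NormedSpace ℝ W]

lemma LatticePeriodic.iteratedFDeriv {u : (Fin n → ℝ) → V} (hp : LatticePeriodic u) (i : ℕ) :
    LatticePeriodic (iteratedFDeriv ℝ i u) := fun x z => by
  rw [← iteratedFDeriv_comp_add_right, funext fun y => hp y z]

/-- Cutoff functions for the open unit cube that equal one off a set of small measure. -/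
lemma exists_cutoff {ε : ENNReal} (hε : ε ≠ 0) :
    ∃ (K : Set (Fin n → ℝ)) (φ : (Fin n → ℝ) → ℝ),
      volume (openUnitCube n \ K) < ε ∧ ContDiff ℝ (⊤ : ℕ∞) φ ∧
      tsupport φ ⊆ openUnitCube n ∧ (∀ x ∈ K, φ =ᶠ[nhds x] fun _ => 1) ∧
      ∀ x, φ x ∈ Set.Icc (0 : ℝ) 1 := by
  have hfin : volume (openUnitCube n) ≠ ⊤ :=
    ne_top_of_le_ne_top isCompact_Icc.measure_lt_top.ne (measure_mono openUnitCube_subset_Icc)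
  obtain ⟨K, hKU, hK, hμ⟩ := isOpen_openUnitCube.measurableSet.exists_isCompact_sdiff_lt hfin hε
  obtain ⟨L, hL, hKL, hLU⟩ := exists_compact_between hK isOpen_openUnitCube hKU
  obtain ⟨φ, h1, h0, hI⟩ := exists_contMDiffMap_one_nhds_of_subset_interior (n := (⊤ : ℕ∞))
    (modelWithCornersSelf ℝ (Fin n → ℝ)) hK.isClosed hKL
  refine ⟨K, φ, hμ, φ.contMDiff.contDiff, ?_, fun x hx => ?_, hI⟩
  · refine (closure_minimal (fun x hx => ?_) hL.isClosed).trans hLU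
    by_contra hxL
    exact hx (h0 x hxL)
  · exact h1.filter_mono (nhds_le_nhdsSet hx)

/-- After a sufficiently fine rescaling, cutting off a smooth periodic function does not
affect the size of its top-order derivatives by more than a universal amount. -/
lemma exists_norm_iteratedFDeriv_cutoff_le {u : (Fin n → ℝ) → V}
    (hu : ContDiff ℝ (⊤ : ℕ∞) u) (hp : LatticePeriodic u) (l : ℕ) :
    ∃ M : ℝ, ∀ φ : (Fin n → ℝ) → ℝ, ContDiff ℝ (⊤ : ℕ∞) φ → HasCompactSupport φ →
      (∀ x, φ x ∈ Set.Icc (0 : ℝ) 1) → ∃ j : ℕ, j ≠ 0 ∧ ∀ x,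
        ‖iteratedFDeriv ℝ l (fun y => φ y • (((j : ℝ) ^ l)⁻¹ • u ((j : ℝ) • y))) x‖ ≤ M := by
  have hle : ∀ i : ℕ, (i : WithTop ℕ∞) ≤ (⊤ : ℕ∞) := fun i => by exact_mod_cast le_top
  choose M hM0 hM using fun i => (hp.iteratedFDeriv i).exists_norm_le
    (hu.continuous_iteratedFDeriv (hle i))
  refine ⟨M l + 1, fun φ hφ hc hI => ?_⟩
  choose P hP using fun i => (hc.iteratedFDeriv (𝕜 := ℝ) i).exists_bound_of_continuous
    (hφ.continuous_iteratedFDeriv (hle i))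
  have hP0 : ∀ i, 0 ≤ P i := fun i => (norm_nonneg _).trans (hP i 0)
  obtain ⟨j, hj⟩ := exists_nat_ge
    (∑ i ∈ Finset.range l, (l.choose (i + 1) : ℝ) * P (i + 1) * M (l - (i + 1)) + 1)
  have hS : 0 ≤ ∑ i ∈ Finset.range l, (l.choose (i + 1) : ℝ) * P (i + 1) * M (l - (i + 1)) :=
    Finset.sum_nonneg fun i _ => mul_nonneg (mul_nonneg (by positivity) (hP0 _)) (hM0 _)
  have hj1 : (1 : ℝ) ≤ j := by linarith
  have hj0 : (0 : ℝ) < j := by linarith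
  refine ⟨j, by exact_mod_cast hj0.ne', fun x => ?_⟩
  have huj : ContDiff ℝ (⊤ : ℕ∞) fun y => u ((j : ℝ) • y) := hu.comp (contDiff_const_smul _)
  have hder : ∀ i ≤ l, ‖iteratedFDeriv ℝ (l - i)
      (fun y => ((j : ℝ) ^ l)⁻¹ • u ((j : ℝ) • y)) x‖ ≤ ((j : ℝ) ^ i)⁻¹ * M (l - i) := by
    intro i hi
    rw [iteratedFDeriv_const_smul_apply' (huj.contDiffAt.of_le (hle (l - i))),
      iteratedFDeriv_comp_const_smul _ (hu.of_le (hle (l - i))), smul_smul,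
      norm_smul]
    have : ((j : ℝ) ^ l)⁻¹ * (j : ℝ) ^ (l - i) = ((j : ℝ) ^ i)⁻¹ := by
      rw [← Nat.sub_add_cancel hi, pow_add, Nat.add_sub_cancel]
      field_simp
    rw [this, Real.norm_of_nonneg (by positivity)]
    gcongr
    exact hM _ _
  refine (norm_iteratedFDeriv_smul_le (n := l) (hφ.of_le (hle l))
    ((huj.const_smul _).of_le (hle l)) x le_rfl).trans ?_
  rw [Finset.sum_range_succ']
  have hzero : ((l.choose 0 : ℕ) : ℝ) * ‖iteratedFDeriv ℝ 0 φ x‖ * ‖iteratedFDeriv ℝ (l - 0)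
      (fun y => ((j : ℝ) ^ l)⁻¹ • u ((j : ℝ) • y)) x‖ ≤ M l := by
    have h := hder 0 (Nat.zero_le _)
    have h1 : ‖φ x‖ ≤ 1 := by
      rw [Real.norm_of_nonneg (hI x).1]
      exact (hI x).2
    simp only [pow_zero, inv_one, one_mul, Nat.sub_zero] at h
    simp only [Nat.choose_zero_right, Nat.cast_one, one_mul, norm_iteratedFDeriv_zero,
      Nat.sub_zero]
    calc _ ≤ 1 * M l := by gcongr
      _ = M l := one_mul _
  have hrest : ∑ i ∈ Finset.range l, (l.choose (i + 1) : ℝ) * ‖iteratedFDeriv ℝ (i + 1) φ x‖ *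
      ‖iteratedFDeriv ℝ (l - (i + 1)) (fun y => ((j : ℝ) ^ l)⁻¹ • u ((j : ℝ) • y)) x‖ ≤ 1 := by
    calc _ ≤ ∑ i ∈ Finset.range l, (l.choose (i + 1) : ℝ) * P (i + 1) *
          ((j : ℝ)⁻¹ * M (l - (i + 1))) := by
          refine Finset.sum_le_sum fun i hi => ?_
          have hinv : ((j : ℝ) ^ (i + 1))⁻¹ ≤ (j : ℝ)⁻¹ :=
            inv_anti₀ hj0 (le_self_pow₀ hj1 (Nat.succ_ne_zero i))
          have := hP0 (i + 1)
          gcongr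
          · exact hP _ _
          · exact (hder (i + 1) (Finset.mem_range.mp hi)).trans
              (mul_le_mul_of_nonneg_right hinv (hM0 _))
      _ = (j : ℝ)⁻¹ *
          ∑ i ∈ Finset.range l, (l.choose (i + 1) : ℝ) * P (i + 1) * M (l - (i + 1)) := by
          rw [Finset.mul_sum]
          exact Finset.sum_congr rfl fun i _ => by ring
      _ ≤ (j : ℝ)⁻¹ * j := by
          gcongr
          linarith
      _ = 1 := inv_mul_cancel₀ hj0.ne'
  linarith

/-- Two functions bounded by `C` that agree on a large part of the open unit cube have
nearly the same integral. -/
lemma integral_cube_le_add {F G : (Fin n → ℝ) → ℝ} {C ε : ℝ} {K : Set (Fin n → ℝ)}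
    (hF : Measurable F) (hG : Measurable G) (hFC : ∀ x, |F x| ≤ C) (hGC : ∀ x, |G x| ≤ C)
    (hμ : volume (openUnitCube n \ K) < ENNReal.ofReal ε) (hFG : ∀ x ∈ K, F x = G x) :
    ∫ x in Set.Icc (0 : Fin n → ℝ) 1, F x ≤
      (∫ x in Set.Icc (0 : Fin n → ℝ) 1, G x) + 2 * C * ε := by
  have hC : 0 ≤ C := (abs_nonneg _).trans (hFC 0)
  have hε : 0 < ε := ENNReal.ofReal_pos.mp (bot_le.trans_lt hμ)
  have hint : ∀ H : (Fin n → ℝ) → ℝ, Measurable H → (∀ x, |H x| ≤ C) →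
      IntegrableOn H (openUnitCube n) := fun H hH hHC =>
    Measure.integrableOn_of_bounded
      (ne_top_of_le_ne_top isCompact_Icc.measure_lt_top.ne (measure_mono openUnitCube_subset_Icc))
      hH.aestronglyMeasurable (Filter.Eventually.of_forall hHC)
  rw [← setIntegral_congr_set openUnitCube_ae_eq, ← setIntegral_congr_set openUnitCube_ae_eq,
    ← sub_le_iff_le_add', ← integral_sub (hint F hF hFC) (hint G hG hGC),
    setIntegral_eq_of_subset_of_forall_sdiff_eq_zero isOpen_openUnitCube.measurableSet
      (s := openUnitCube n \ K) Set.sdiff_subset fun x hx => ?_]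
  · refine (Real.le_norm_self _).trans ((norm_setIntegral_le_of_norm_le_const
      (C := 2 * C) (hμ.trans ENNReal.ofReal_lt_top) fun x _ => ?_).trans ?_)
    · rw [Real.norm_eq_abs]
      exact (abs_sub _ _).trans (by linarith [hFC x, hGC x])
    · gcongr
      exact ENNReal.toReal_le_of_le_ofReal hε.le hμ.le
  · have hxK : x ∈ K := by
      by_contra h
      exact hx.2 ⟨hx.1, h⟩
    rw [hFG x hxK, sub_self]

/-- A periodic potential can be replaced by a compactly supported one at arbitrarily small cost. -/
lemma exists_integral_compact_support_le [FiniteDimensional ℝ V]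
    [MeasurableSpace W] [BorelSpace W]
    {l : ℕ} (B : (Fin n → ℕ) → (V →ₗ[ℝ] W)) {f : W → ℝ} (hf : Measurable f)
    (hfb : ∀ R : ℝ, ∃ C : ℝ, ∀ η : W, ‖η‖ ≤ R → |f η| ≤ C) (η : W)
    {u : (Fin n → ℝ) → V} (hu : ContDiff ℝ (⊤ : ℕ∞) u) (hp : LatticePeriodic u)
    {δ : ℝ} (hδ : 0 < δ) :
    ∃ v : (Fin n → ℝ) → V, ContDiff ℝ (⊤ : ℕ∞) v ∧ tsupport v ⊆ openUnitCube n ∧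
      ∫ x in Set.Icc (0 : Fin n → ℝ) 1, f (η + diffOp l B v x) ≤
        (∫ x in Set.Icc (0 : Fin n → ℝ) 1, f (η + diffOp l B u x)) + δ := by
  obtain ⟨D, hD0, hD⟩ := exists_norm_diffOp_le (k := l) B
  obtain ⟨M, hM⟩ := exists_norm_iteratedFDeriv_cutoff_le hu hp l
  have hBu := contDiff_diffOp (k := l) B hu
  obtain ⟨N, -, hN⟩ := (hp.diffOp (k := l) B).exists_norm_le hBu.continuous
  obtain ⟨C, hC⟩ := hfb (‖η‖ + max (D * M) N)
  have hC' : ∀ w : W, ‖w‖ ≤ max (D * M) N → |f (η + w)| ≤ C := fun w hw =>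
    hC _ ((norm_add_le _ _).trans (by gcongr))
  have hC0 : 0 ≤ C := (abs_nonneg _).trans (hC' _ ((hN 0).trans (le_max_right _ _)))
  have hε : 0 < δ / (2 * C + 1) := by positivity
  obtain ⟨K, φ, hμ, hφ, hs, h1, hI⟩ :=
    exists_cutoff (n := n) (ENNReal.ofReal_pos.mpr hε).ne'
  have hc : HasCompactSupport φ := isCompact_Icc.of_isClosed_subset (isClosed_tsupport φ)
    (hs.trans openUnitCube_subset_Icc)
  obtain ⟨j, hj, hjM⟩ := hM φ hφ hc hI
  have hj' : (j : ℝ) ≠ 0 := by exact_mod_cast hj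
  have huj : ContDiff ℝ (⊤ : ℕ∞) fun y => ((j : ℝ) ^ l)⁻¹ • u ((j : ℝ) • y) :=
    (hu.comp (contDiff_const_smul _)).const_smul _
  have hv : ContDiff ℝ (⊤ : ℕ∞) fun y => φ y • (((j : ℝ) ^ l)⁻¹ • u ((j : ℝ) • y)) :=
    hφ.smul huj
  refine ⟨fun y => φ y • (((j : ℝ) ^ l)⁻¹ • u ((j : ℝ) • y)), hv,
    (tsupport_smul_subset_left _ _).trans hs, ?_⟩
  have hmeas : ∀ g : (Fin n → ℝ) → W, Continuous g → Measurable fun x => f (η + g x) :=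
    fun g hg => hf.comp (continuous_const.add hg).measurable
  have hle := integral_cube_le_add (hmeas _ (contDiff_diffOp (k := l) B hv).continuous)
    (hmeas (fun x => diffOp l B u ((j : ℝ) • x)) (hBu.continuous.comp (continuous_const_smul _)))
    (fun x => hC' _ (((hD _ hv x).trans (mul_le_mul_of_nonneg_left (hjM x) hD0)).trans
      (le_max_left _ _)))
    (fun x => hC' _ ((hN _).trans (le_max_right _ _))) hμ fun x hx => by
      rw [← diffOp_rescale B hu hj' x]
      refine congrArg (fun w => f (η + w)) (diffOp_congr B ?_)
      filter_upwards [h1 x hx] with y hy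
      rw [hy, one_smul]
  refine hle.trans (add_le_add (le_of_eq ?_) ?_)
  · exact LatticePeriodic.integral_comp_smul (g := fun x => f (η + diffOp l B u x))
      (fun x z => congrArg (fun w => f (η + w)) (hp.diffOp B x z)) (hmeas _ hBu.continuous) hj
  · rw [mul_div_assoc', div_le_iff₀ (by positivity)]
    nlinarith

lemma QBenv_le_QAenv {X : Type*} [NormedAddCommGroup X] [NormedSpace ℝ X]
    [FiniteDimensional ℝ V] [FiniteDimensional ℝ W] [FiniteDimensional ℝ X]
    [MeasurableSpace W] [BorelSpace W] {k l : ℕ}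
    (A : (Fin n → ℕ) → (W →ₗ[ℝ] X)) (B : (Fin n → ℕ) → (V →ₗ[ℝ] W))
    (hB : ∃ s : ℕ, ∀ ξ : Fin n → ℝ, ξ ≠ 0 →
      Module.finrank ℝ (LinearMap.range (symbolOf l B ξ)) = s)
    (hexact : ∀ ξ : Fin n → ℝ, ξ ≠ 0 →
      LinearMap.ker (symbolOf k A ξ) = LinearMap.range (symbolOf l B ξ))
    {f : W → ℝ} (hf : Measurable f)
    (hfb : ∀ R : ℝ, ∃ C : ℝ, ∀ η : W, ‖η‖ ≤ R → |f η| ≤ C) (η : W) :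
    QBenv (l := l) B f η ≤ QAenv (k := k) A f η := by
  refine le_sInf ?_
  rintro y ⟨w, hw, hp, hAw, hmean, rfl⟩
  obtain ⟨u, hu, hup, huw⟩ := exists_diffOp_eq A B hB hexact hw hp hAw hmean
  refine EReal.le_of_forall_lt_iff_le.mp fun q hq => ?_
  obtain ⟨v, hv, hs, hle⟩ := exists_integral_compact_support_le (l := l) B hf hfb η hu hup
    (sub_pos.mpr (EReal.coe_lt_coe_iff.mp hq))
  simp only [huw, add_sub_cancel] at hle
  exact le_trans (b := ((_ : ℝ) : EReal)) (sInf_le ⟨v, hv, hs, rfl⟩) (EReal.coe_le_coe_iff.mpr hle)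

end CutOff

end PeriodicDiffOp

/-- **Corollary 3.2.** Let `A`, `B` be homogeneous constant-coefficient linear
differential operators of orders `k` and `l`, both of constant rank, with
`ker A(ξ) = im B(ξ)` for all `ξ ≠ 0`, and let `f : W → ℝ` be Borel measurable and
locally bounded. Then the envelopes `Q_A f` and `Q^B f` agree at every `η ∈ W`. -/
theorem QAenv_eq_QBenv
    {n k l : ℕ} (hn : 1 ≤ n) (hk : 1 ≤ k) (hl : 1 ≤ l)
    {V W X : Type*}
    [NormedAddCommGroup V] [InnerProductSpace ℝ V] [FiniteDimensional ℝ V]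
    [NormedAddCommGroup W] [InnerProductSpace ℝ W] [FiniteDimensional ℝ W]
    [MeasurableSpace W] [BorelSpace W]
    [NormedAddCommGroup X] [InnerProductSpace ℝ X] [FiniteDimensional ℝ X]
    (Acoef : (Fin n → ℕ) → (W →ₗ[ℝ] X)) (Bcoef : (Fin n → ℕ) → (V →ₗ[ℝ] W))
    (hArank : ∃ r : ℕ, ∀ ξ : Fin n → ℝ, ξ ≠ 0 →
      Module.finrank ℝ (LinearMap.range (symbolOf k Acoef ξ)) = r)
    (hBrank : ∃ s : ℕ, ∀ ξ : Fin n → ℝ, ξ ≠ 0 →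
      Module.finrank ℝ (LinearMap.range (symbolOf l Bcoef ξ)) = s)
    (hexact : ∀ ξ : Fin n → ℝ, ξ ≠ 0 →
      LinearMap.ker (symbolOf k Acoef ξ) = LinearMap.range (symbolOf l Bcoef ξ))
    (f : W → ℝ) (hf_meas : Measurable f)
    (hf_locbdd : ∀ R : ℝ, ∃ C : ℝ, ∀ η : W, ‖η‖ ≤ R → |f η| ≤ C) :
    ∀ η : W, QAenv (k := k) Acoef f η = QBenv (l := l) Bcoef f η := by
  intro η
  exact le_antisymm (PeriodicDiffOp.QAenv_le_QBenv hl Acoef Bcoef hexact f η)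
    (PeriodicDiffOp.QBenv_le_QAenv Acoef Bcoef hBrank hexact hf_meas hf_locbdd η)
end
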